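/- arXiv:1903.07548 — 2 statements merged into one kernel-verified Lean document; each statement's English description precedes it below -/
import Mathlib

section
/- Let R be an invariant of signed graphs with values in a field, invariant under switching equivalence and multiplicative over disjoint unions, and suppose there are constants α, β, γ, x, y, z with α, β, γ ≠ 0 such that for every signed graph Σ=(Γ=(V,E),σ) and every edge e with σ(e)=+1: (i) R_Σ = α·R_{Σ/e} + β·R_{Σ\e} if e is ordinary in Γ (neither loop nor bridge) and k_u(Σ\e) = k_u(Σ); (ii) R_Σ = α·R_{Σ/e} + γ·R_{Σ\e} if e is ordinary in Γ and k_u(Σ\e) < k_u(Σ); (iii) R_Σ = α·R_{Σ/e} + (β(x−α)/γ)·R_{Σ\e} if e is a bridge in Γ and a circuit path edge in Σ; (iv) R_Σ = x·R_{Σ/e} if e is a bridge in Γ that is not a circuit path edge in Σ; (v) R_Σ = y·R_{Σ\e} if e is a loop in Γ; and furthermore R_Σ = β^{ℓ−1}·γ + (z−γ)·Σ_{i=0}^{ℓ−1} y^{ℓ−1−i} β^i when Σ is a single vertex with ℓ ≥ 1 negative loops, and R_Σ = 1 when Σ is a single vertex with no edges. Then for every signed graph Σ, R_Σ = α^{|V|−k(Σ)}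 · β^{|E|−|V|+k_b(Σ)} · γ^{k_u(Σ)} · T_Σ(x/α, y/β, z/γ). -/
attribute [local instance] Classical.propDecidable

noncomputable section SignedGraphs

/-- A signed graph: a multigraph with ordered pairs of endpoints (the order is
an artefact of the encoding) together with a sign `±1` on each edge. -/
structure SGraph (V : Type*) (E : Type*) where
  ends : E → V × V
  sign : E → ℤˣ

namespace SGraph

variable {V E : Type*}

/-- Endpoint of `e` on side `b`; a loop has both endpoints equal, but its two
half-edges are distinguished by the side `b`. -/
def endpt (Γ : SGraph V E) (e : E) (b : Bool) : V :=
  cond b (Γ.ends e).1 (Γ.ends e).2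

/-- `e` is a loop of the underlying graph. -/
def IsLoop (Γ : SGraph V E) (e : E) : Prop := (Γ.ends e).1 = (Γ.ends e).2

/-- Walks in a signed multigraph: a step traverses an edge `e` in direction `d`
(from the side-`d` endpoint to the other endpoint). -/
inductive Walk (Γ : SGraph V E) : V → V → Type _
  | nil (v : V) : Walk Γ v v
  | cons (e : E) (d : Bool) {w : V} (p : Walk Γ (Γ.endpt e (!d)) w) : Walk Γ (Γ.endpt e d) w

namespace Walk

variable {Γ : SGraph V E}

/-- The list of vertices visited by a walk (including the final one). -/
def verts : ∀ {u v : V}, Γ.Walk u v → List V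
  | _, _, .nil x => [x]
  | _, _, .cons e d p => Γ.endpt e d :: p.verts

/-- The list of edges traversed by a walk. -/
def edges : ∀ {u v : V}, Γ.Walk u v → List E
  | _, _, .nil _ => []
  | _, _, .cons e _ p => e :: p.edges

/-- The list of (edge, direction) steps of a walk. -/
def steps : ∀ {u v : V}, Γ.Walk u v → List (E × Bool)
  | _, _, .nil _ => []
  | _, _, .cons e d p => (e, d) :: p.steps

/-- The sources of the steps of a walk, i.e. all visited vertices except the last. -/
def srcs {u v : V} (W : Γ.Walk u v) : List V := W.verts.dropLast

/-- The sign of a walk: the product of the signs of its edges. -/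
def sgn : ∀ {u v : V}, Γ.Walk u v → ℤˣ
  | _, _, .nil _ => 1
  | _, _, .cons e _ p => Γ.sign e * p.sgn

/-- Concatenation of walks. -/
def append : ∀ {u v w : V}, Γ.Walk u v → Γ.Walk v w → Γ.Walk u w
  | _, _, _, .nil _, q => q
  | _, _, _, .cons e d p, q => .cons e d (p.append q)

/-- The sum `Σᵢ f(eᵢ)` of the values of `f` on the edges of the walk,
with multiplicity. -/
def edgeSum {G : Type*} [AddCommGroup G] (f : E → G) {u v : V} (W : Γ.Walk u v) : G :=
  (W.edges.map f).sum

/-- The sum `Σᵢ ω(vᵢ,eᵢ)·(Π_{j<i} σ(eⱼ))·f(eᵢ)` along a walk, where `ω(vᵢ,eᵢ)`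
is the value of `ω` on the half-edge by which the walk leaves `vᵢ`. -/
def tensionSum {G : Type*} [AddCommGroup G] (ω : E → Bool → ℤˣ) (f : E → G) :
    ∀ {u v : V}, Γ.Walk u v → G
  | _, _, .nil _ => 0
  | _, _, .cons e d p => ((ω e d : ℤ) • f e) + ((Γ.sign e : ℤ) • tensionSum ω f p)

/-- `Q` is the reverse of the walk `P`. -/
def IsReverseOf {u v : V} (Q : Γ.Walk v u) (P : Γ.Walk u v) : Prop :=
  Q.steps = P.steps.reverse.map fun s => (s.1, !s.2)

end Walk

/-- A closed walk is a cycle if it is nontrivial, visits no vertex twice and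
uses no edge twice. -/
def IsCycle (Γ : SGraph V E) {v : V} (W : Γ.Walk v v) : Prop :=
  W.edges ≠ [] ∧ W.srcs.Nodup ∧ W.edges.Nodup

/-- A balanced (positive) cycle. -/
def IsBalancedCycle (Γ : SGraph V E) {v : V} (W : Γ.Walk v v) : Prop :=
  Γ.IsCycle W ∧ W.sgn = 1

/-- An unbalanced (negative) cycle. -/
def IsUnbalancedCycle (Γ : SGraph V E) {v : V} (W : Γ.Walk v v) : Prop :=
  Γ.IsCycle W ∧ W.sgn = -1

/-- A nontrivial walk that is a simple path (all visited vertices distinct). -/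
def IsPathWalk (Γ : SGraph V E) {u v : V} (P : Γ.Walk u v) : Prop :=
  P.edges ≠ [] ∧ P.verts.Nodup

/-- A tight handcuff at `v`: two edge-disjoint unbalanced cycles sharing exactly
the vertex `v`. -/
def IsTightHandcuff (Γ : SGraph V E) {v : V} (C₁ C₂ : Γ.Walk v v) : Prop :=
  Γ.IsUnbalancedCycle C₁ ∧ Γ.IsUnbalancedCycle C₂ ∧
    (∀ x ∈ C₁.srcs, x ∈ C₂.srcs → x = v) ∧ ∀ e ∈ C₁.edges, e ∉ C₂.edges

/-- A loose handcuff: two vertex-disjoint unbalanced cycles `C₁` (at `u`) and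
`C₂` (at `w`) joined by a simple path `P` from `u` to `w` meeting the cycles
exactly in its endpoints. -/
def IsLooseHandcuff (Γ : SGraph V E) {u w : V} (C₁ : Γ.Walk u u) (P : Γ.Walk u w)
    (C₂ : Γ.Walk w w) : Prop :=
  Γ.IsUnbalancedCycle C₁ ∧ Γ.IsUnbalancedCycle C₂ ∧ Γ.IsPathWalk P ∧
    (∀ x ∈ C₁.srcs, x ∉ C₂.srcs) ∧
    (∀ x ∈ P.verts, x ∈ C₁.srcs → x = u) ∧
    (∀ x ∈ P.verts, x ∈ C₂.srcs → x = w) ∧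
    ∀ e ∈ P.edges, e ∉ C₁.edges ∧ e ∉ C₂.edges

/-- The canonical closed walks traversing a circuit of the signed graph:
a balanced cycle, a tight handcuff `C₁ * C₂`, or a loose handcuff
`C₁ * P * C₂ * P⁻¹` (the circuit path edges being used twice). -/
def IsBasicCircuitWalk (Γ : SGraph V E) {v : V} (W : Γ.Walk v v) : Prop :=
  Γ.IsBalancedCycle W ∨
    (∃ C₁ C₂ : Γ.Walk v v, Γ.IsTightHandcuff C₁ C₂ ∧ W = C₁.append C₂) ∨
    ∃ (w : V) (C₁ : Γ.Walk v v) (P : Γ.Walk v w) (C₂ : Γ.Walk w w) (Q : Γ.Walk w v),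
      Γ.IsLooseHandcuff C₁ P C₂ ∧ Q.IsReverseOf P ∧
        W = C₁.append (P.append (C₂.append Q))

/-- A circuit walk: a rotation of a basic circuit walk. -/
def IsCircuitWalk (Γ : SGraph V E) {v : V} (W : Γ.Walk v v) : Prop :=
  ∃ (u : V) (A : Γ.Walk u v) (B : Γ.Walk v u),
    W = B.append A ∧ Γ.IsBasicCircuitWalk (A.append B)

/-- `e` is a circuit path edge: it lies on the connecting path of an unbalanced
loose handcuff. -/
def IsCircuitPathEdge (Γ : SGraph V E) (e : E) : Prop :=
  ∃ (u w : V) (C₁ : Γ.Walk u u) (P : Γ.Walk u w) (C₂ : Γ.Walk w w),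
    Γ.IsLooseHandcuff C₁ P C₂ ∧ e ∈ P.edges

/-- Adjacency via an edge. -/
def Adj (Γ : SGraph V E) (a b : V) : Prop := ∃ e, Γ.ends e = (a, b) ∨ Γ.ends e = (b, a)

/-- The set of connected components. -/
def Components (Γ : SGraph V E) : Type _ := Quot Γ.Adj

/-- The connected component of a vertex. -/
def comp (Γ : SGraph V E) (v : V) : Γ.Components := Quot.mk _ v

/-- The number `k(Γ)` of connected components. -/
def kAll (Γ : SGraph V E) : ℕ := Nat.card Γ.Components

/-- A connected component is balanced if every cycle it contains is balanced. -/
def IsBalancedComponent (Γ : SGraph V E) (c : Γ.Components) : Prop :=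
  ∀ v : V, Γ.comp v = c → ∀ W : Γ.Walk v v, Γ.IsCycle W → W.sgn = 1

/-- The number `k_b(Σ)` of balanced connected components. -/
def kb (Γ : SGraph V E) : ℕ := Nat.card {c : Γ.Components // Γ.IsBalancedComponent c}

/-- The number `k_u(Σ)` of unbalanced connected components. -/
def ku (Γ : SGraph V E) : ℕ := Nat.card {c : Γ.Components // ¬ Γ.IsBalancedComponent c}

/-- A signed graph is balanced if all its cycles are balanced. -/
def Balanced (Γ : SGraph V E) : Prop :=
  ∀ (v : V) (W : Γ.Walk v v), Γ.IsCycle W → W.sgn = 1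

/-- A signed graph is connected if it has exactly one connected component. -/
def Connected (Γ : SGraph V E) : Prop := Γ.kAll = 1

/-- The spanning subgraph `Σ \ Aᶜ` with edge set `A`. -/
def restrict (Γ : SGraph V E) (A : Set E) : SGraph V A :=
  { ends := fun e => Γ.ends e, sign := fun e => Γ.sign e }

/-- The signed Tutte polynomial (as a function of `x`, `y`, `z`):
`T_Σ(X,Y,Z) = Σ_{A⊆E} (X−1)^{k(Σ\Aᶜ)−k(Σ)} (Y−1)^{|A|−|V|+k_b(Σ\Aᶜ)} (Z−1)^{k_u(Σ\Aᶜ)}`. -/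
def signedTutte {K : Type*} [CommRing K] (Γ : SGraph V E) (x y z : K) : K :=
  ∑ᶠ A : Finset E,
    (x - 1) ^ ((Γ.restrict (A : Set E)).kAll - Γ.kAll) *
      (y - 1) ^ ((A.card + (Γ.restrict (A : Set E)).kb) - Nat.card V) *
        (z - 1) ^ (Γ.restrict (A : Set E)).ku

/-- Deletion of an edge. -/
def deleteEdge (Γ : SGraph V E) (e : E) : SGraph V {e' : E // e' ≠ e} :=
  { ends := fun e' => Γ.ends e'.1, sign := fun e' => Γ.sign e'.1 }

/-- The relation identifying the two endpoints of `e`. -/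
def contractRel (Γ : SGraph V E) (e : E) (a b : V) : Prop := (a, b) = Γ.ends e

/-- Contraction of an edge: the two endpoints are identified and the edge is
deleted.  (For a loop this is just deletion, as the identification is trivial.) -/
def contract (Γ : SGraph V E) (e : E) : SGraph (Quot (Γ.contractRel e)) {e' : E // e' ≠ e} :=
  { ends := fun e' => (Quot.mk _ (Γ.ends e'.1).1, Quot.mk _ (Γ.ends e'.1).2),
    sign := fun e' => Γ.sign e'.1 }

/-- `e` is a bridge: its deletion increases the number of connected components. -/
def IsBridge (Γ : SGraph V E) (e : E) : Prop := Γ.kAll < (Γ.deleteEdge e).kAll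

/-- An orientation of the half-edges, compatible with the signature. -/
def IsCompatible (Γ : SGraph V E) (ω : E → Bool → ℤˣ) : Prop :=
  ∀ e, Γ.sign e = -(ω e true * ω e false)

/-- A `G`-flow: Kirchhoff's law holds at every vertex. -/
def IsFlow (Γ : SGraph V E) (ω : E → Bool → ℤˣ) {G : Type*} [AddCommGroup G]
    (f : E → G) : Prop :=
  ∀ v : V,
    (∑ᶠ e : E, ((if Γ.endpt e true = v then (ω e true : ℤ) • f e else 0) +
      (if Γ.endpt e false = v then (ω e false : ℤ) • f e else 0))) = 0

/-- A `G`-tension: the alternating sum along every circuit walk vanishes. -/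
def IsTension (Γ : SGraph V E) (ω : E → Bool → ℤˣ) {G : Type*} [AddCommGroup G]
    (f : E → G) : Prop :=
  ∀ (v : V) (W : Γ.Walk v v), Γ.IsCircuitWalk W → W.tensionSum ω f = 0

end SGraph

/-- The doubling homomorphism `x ↦ x + x = 2x` of an abelian group. -/
def doubleHom (G : Type*) [AddCommGroup G] : G →+ G :=
  AddMonoidHom.mk' (fun x => x + x) (fun a b => add_add_add_comm a b a b)

/-- The subgroup `2G = {2x : x ∈ G}`. -/
def twoG (G : Type*) [AddCommGroup G] : AddSubgroup G := (doubleHom G).range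

/-- The `2`-torsion subgroup `G₂ = {x ∈ G : 2x = 0}`. -/
def torsion2 (G : Type*) [AddCommGroup G] : AddSubgroup G := (doubleHom G).ker

namespace SGraph

variable {V E : Type*}

/-- A `G`-potential difference: a `G`-tension whose sum around every unbalanced
cycle lies in `2G`. -/
def IsPotentialDifference (Γ : SGraph V E) (ω : E → Bool → ℤˣ) {G : Type*} [AddCommGroup G]
    (f : E → G) : Prop :=
  Γ.IsTension ω f ∧
    ∀ (v : V) (W : Γ.Walk v v), Γ.IsUnbalancedCycle W → W.edgeSum f ∈ twoG G

end SGraph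

namespace SGraph

variable {V E : Type*}

/-- Proper coloring by elements of a set `X` with involution `ι`: adjacent
endpoints of a positive edge get different colors, and for a negative edge the
`ι`-image of one endpoint's color differs from the other endpoint's color. -/
def IsProperInvColoring (Γ : SGraph V E) {X : Type*} (ι : X → X) (f : V → X) : Prop :=
  ∀ e : E, (Γ.sign e = 1 → f ((Γ.ends e).1) ≠ f ((Γ.ends e).2)) ∧
    (Γ.sign e = -1 → ι (f ((Γ.ends e).1)) ≠ f ((Γ.ends e).2))

/-- A proper `G`-coloring: for every edge `e = uv`, `f(u) ≠ f(v)` if `e` is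
positive and `-f(u) ≠ f(v)` if `e` is negative, i.e. `σ(e)•f(u) ≠ f(v)`. -/
def IsProperColoring (Γ : SGraph V E) {G : Type*} [AddCommGroup G] (f : V → G) : Prop :=
  ∀ e : E, ((Γ.sign e : ℤ) • f ((Γ.ends e).1)) ≠ f ((Γ.ends e).2)

/-- Zaslavsky's proper `n`-coloring: colors in `{0, ±1, …, ±n}` with
`f(u) ≠ σ(e)·f(v)` for every edge `e = uv`. -/
def IsProperNColoring (Γ : SGraph V E) (n : ℕ) (f : V → ℤ) : Prop :=
  (∀ v, |f v| ≤ (n : ℤ)) ∧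
    ∀ e : E, f ((Γ.ends e).1) ≠ (Γ.sign e : ℤ) * f ((Γ.ends e).2)

/-- `T ⊆ E` is a spanning tree: the spanning subgraph `(V,T)` is connected and
contains no cycle. -/
def IsSpanningTree (Γ : SGraph V E) (T : Set E) : Prop :=
  (Γ.restrict T).Connected ∧
    ∀ (v : V) (W : (Γ.restrict T).Walk v v), ¬ (Γ.restrict T).IsCycle W

/-- A connected basis of a connected signed graph: a spanning tree if `Σ` is
balanced; otherwise a spanning tree plus one extra edge closing an unbalanced
cycle. -/
def IsConnectedBasis (Γ : SGraph V E) (B : Set E) : Prop :=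
  (Γ.Balanced ∧ Γ.IsSpanningTree B) ∨
    (¬ Γ.Balanced ∧ ∃ (T : Set E) (e : E), Γ.IsSpanningTree T ∧ e ∉ T ∧ B = insert e T ∧
      ∀ (v : V) (W : (Γ.restrict B).Walk v v), (Γ.restrict B).IsCycle W → W.sgn = -1)

/-- Switching at a vertex `v`: the sign of every non-loop edge incident with `v`
is negated; loops keep their sign. -/
def switchAt (Γ : SGraph V E) (v : V) : SGraph V E :=
  { ends := Γ.ends,
    sign := fun e => if ((Γ.ends e).1 = v ↔ (Γ.ends e).2 = v) then Γ.sign e else -Γ.sign e }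

/-- Switching at a set `S` of vertices (the composite of the switchings at the
vertices of `S`): the sign of an edge is negated iff exactly one of its
endpoints lies in `S`. -/
def switchSet (Γ : SGraph V E) (S : Set V) : SGraph V E :=
  { ends := Γ.ends,
    sign := fun e => if ((Γ.ends e).1 ∈ S ↔ (Γ.ends e).2 ∈ S) then Γ.sign e else -Γ.sign e }

/-- Isomorphism of signed graphs (as undirected signed multigraphs). -/
def Iso {V₁ E₁ V₂ E₂ : Type*} (Γ₁ : SGraph V₁ E₁) (Γ₂ : SGraph V₂ E₂) : Prop :=
  ∃ (φ : V₁ ≃ V₂) (ψ : E₁ ≃ E₂), ∀ e : E₁,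
    (Γ₂.ends (ψ e) = (φ (Γ₁.ends e).1, φ (Γ₁.ends e).2) ∨
      Γ₂.ends (ψ e) = (φ (Γ₁.ends e).2, φ (Γ₁.ends e).1)) ∧
    Γ₂.sign (ψ e) = Γ₁.sign e

/-- Switching equivalence: isomorphism after switching at a set of vertices. -/
def SwitchEquiv {V₁ E₁ V₂ E₂ : Type*} (Γ₁ : SGraph V₁ E₁) (Γ₂ : SGraph V₂ E₂) : Prop :=
  ∃ S : Set V₁, Iso (Γ₁.switchSet S) Γ₂

/-- Disjoint union of signed graphs. -/
def disjUnion {V₁ E₁ V₂ E₂ : Type*} (Γ₁ : SGraph V₁ E₁) (Γ₂ : SGraph V₂ E₂) :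
    SGraph (V₁ ⊕ V₂) (E₁ ⊕ E₂) where
  ends := fun e => match e with
    | .inl e => (Sum.inl (Γ₁.ends e).1, Sum.inl (Γ₁.ends e).2)
    | .inr e => (Sum.inr (Γ₂.ends e).1, Sum.inr (Γ₂.ends e).2)
  sign := fun e => match e with
    | .inl e => Γ₁.sign e
    | .inr e => Γ₂.sign e

/-- The difference operator `δ : G^V → G^E`,
`(δg)(e) = ω(v,e)·g(v) + ω(u,e)·g(u)` for `e = uv`. -/
def deltaHom (Γ : SGraph V E) (ω : E → Bool → ℤˣ) (G : Type*) [AddCommGroup G] :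
    (V → G) →+ (E → G) :=
  AddMonoidHom.mk'
    (fun g e => (ω e true : ℤ) • g ((Γ.ends e).1) + (ω e false : ℤ) • g ((Γ.ends e).2))
    (by
      intro a b
      funext e
      simp only [Pi.add_apply, smul_add]
      abel)

end SGraph

end SignedGraphs

noncomputable section Recipe
open SGraph

/-- Quotient cardinality comparison. -/
theorem rq_card_eq {X Y : Type*} {r : X → X → Prop} {s : Y → Y → Prop}
    (F : X → Quot s) (G : Y → Quot r)
    (hF : ∀ a b, r a b → F a = F b) (hG : ∀ a b, s a b → G a = G b)
    (hGF : ∀ x, Quot.lift G hG (F x) = Quot.mk r x)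
    (hFG : ∀ y, Quot.lift F hF (G y) = Quot.mk s y) :
    Nat.card (Quot r) = Nat.card (Quot s) := by
  refine Nat.card_congr ⟨Quot.lift F hF, Quot.lift G hG, ?_, ?_⟩
  · rintro ⟨x⟩; exact hGF x
  · rintro ⟨y⟩; exact hFG y

/-- The relation `r` with one extra pair. -/
def rqAdd {X : Type*} (r : X → X → Prop) (a b : X) : X → X → Prop :=
  fun p q => r p q ∨ (p = a ∧ q = b)

theorem rq_add_mono {X : Type*} {r : X → X → Prop} {a b x y : X}
    (h : Quot.mk r x = Quot.mk r y) : Quot.mk (rqAdd r a b) x = Quot.mk (rqAdd r a b) y :=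
  congrArg (Quot.map (ra := r) (rb := rqAdd r a b) id (fun _ _ h => Or.inl h)) h

theorem rq_add_new {X : Type*} (r : X → X → Prop) (a b : X) :
    Quot.mk (rqAdd r a b) a = Quot.mk (rqAdd r a b) b := Quot.sound (Or.inr ⟨rfl, rfl⟩)

def rqPhi {X : Type*} (r : X → X → Prop) (a b : X) (q : Quot r) : Quot r :=
  if q = Quot.mk r a then Quot.mk r b else q

theorem rq_phi_resp {X : Type*} (r : X → X → Prop) (a b : X) (p q : X) (h : rqAdd r a b p q) :
    rqPhi r a b (Quot.mk r p) = rqPhi r a b (Quot.mk r q) := by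
  rcases h with h | ⟨rfl, rfl⟩
  · rw [Quot.sound h]
  · unfold rqPhi; simp

theorem rq_add_iff {X : Type*} (r : X → X → Prop) (a b x y : X) :
    Quot.mk (rqAdd r a b) x = Quot.mk (rqAdd r a b) y ↔
      Quot.mk r x = Quot.mk r y ∨ (Quot.mk r x = Quot.mk r a ∧ Quot.mk r b = Quot.mk r y) ∨
        (Quot.mk r x = Quot.mk r b ∧ Quot.mk r a = Quot.mk r y) := by
  constructor
  · intro h
    have h2 : rqPhi r a b (Quot.mk r x) = rqPhi r a b (Quot.mk r y) :=
      congrArg (Quot.lift (fun p => rqPhi r a b (Quot.mk r p)) (rq_phi_resp r a b)) h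
    unfold rqPhi at h2
    split_ifs at h2 with h3 h4 h4
    · left; rw [h3, h4]
    · right; left; exact ⟨h3, h2⟩
    · right; right; exact ⟨h2, h4.symm⟩
    · left; exact h2
  · have hn := rq_add_new r a b
    rintro (h | ⟨h, h'⟩ | ⟨h, h'⟩)
    · exact rq_add_mono h
    · exact (rq_add_mono h).trans (hn.trans (rq_add_mono h'))
    · exact (rq_add_mono h).trans (hn.symm.trans (rq_add_mono h'))

theorem rq_add_card_same {X : Type*} (r : X → X → Prop) (a b : X)
    (h : Quot.mk r a = Quot.mk r b) : Nat.card (Quot r) = Nat.card (Quot (rqAdd r a b)) := by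
  refine rq_card_eq (fun x => Quot.mk _ x) (fun x => Quot.mk _ x) ?_ ?_ ?_ ?_
  · intro p q hpq; exact Quot.sound (Or.inl hpq)
  · rintro p q (hpq | ⟨rfl, rfl⟩)
    · exact Quot.sound hpq
    · exact h
  · intro x; rfl
  · intro x; rfl

theorem rq_add_card_diff {X : Type*} [Finite X] (r : X → X → Prop) (a b : X)
    (h : Quot.mk r a ≠ Quot.mk r b) :
    Nat.card (Quot r) = Nat.card (Quot (rqAdd r a b)) + 1 := by
  have e : {q : Quot r // q ≠ Quot.mk r a} ≃ Quot (rqAdd r a b) := by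
    refine Equiv.ofBijective
      (fun q => Quot.map (ra := r) (rb := rqAdd r a b) id (fun _ _ h => Or.inl h) q.1) ⟨?_, ?_⟩
    · rintro ⟨⟨x⟩, hx⟩ ⟨⟨y⟩, hy⟩ hxy
      have := (rq_add_iff r a b x y).1 hxy
      apply Subtype.ext
      rcases this with h | ⟨h, _⟩ | ⟨_, h⟩
      · exact h
      · exact absurd h hx
      · exact absurd h.symm hy
    · rintro ⟨x⟩
      by_cases hx : Quot.mk r x = Quot.mk r a
      · exact ⟨⟨Quot.mk r b, h.symm⟩, ((rq_add_mono hx).trans (rq_add_new r a b)).symm⟩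
      · exact ⟨⟨Quot.mk r x, hx⟩, rfl⟩
  rw [← Nat.card_congr e]
  have := Fintype.ofFinite (Quot r)
  have h1 := Fintype.card_subtype_compl (fun q : Quot r => q = Quot.mk r a)
  have h2 : 0 < Fintype.card (Quot r) := Fintype.card_pos_iff.2 ⟨Quot.mk r a⟩
  simp only [Nat.card_eq_fintype_card]
  rw [Fintype.card_subtype_eq] at h1
  change Fintype.card {q : Quot r // ¬ (q = Quot.mk r a)} = _ at h1
  have h3 : Fintype.card {q : Quot r // q ≠ Quot.mk r a} = Fintype.card (Quot r) - 1 := by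
    rw [← h1]
  omega

namespace SGraph
variable {V E : Type*}

/-- Adjacency through the edges of `S`. -/
def adjS (Γ : SGraph V E) (S : Set E) (a b : V) : Prop := ∃ e ∈ S, Γ.ends e = (a, b)

/-- Adjacency in the signed double cover, through the edges of `S`. -/
def covS (Γ : SGraph V E) (S : Set E) (p q : V × ℤˣ) : Prop :=
  ∃ e ∈ S, Γ.ends e = (p.1, q.1) ∧ q.2 = Γ.sign e * p.2

def kS (Γ : SGraph V E) (S : Set E) : ℕ := Nat.card (Quot (Γ.adjS S))
def dS (Γ : SGraph V E) (S : Set E) : ℕ := Nat.card (Quot (Γ.covS S))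

/-- connected in the subgraph -/
def cc (Γ : SGraph V E) (S : Set E) (u v : V) : Prop := Quot.mk (Γ.adjS S) u = Quot.mk (Γ.adjS S) v
/-- connected in the cover -/
def dc (Γ : SGraph V E) (S : Set E) (p q : V × ℤˣ) : Prop :=
  Quot.mk (Γ.covS S) p = Quot.mk (Γ.covS S) q

theorem cc_of_dc {Γ : SGraph V E} {S : Set E} {p q : V × ℤˣ} (h : Γ.dc S p q) :
    Γ.cc S p.1 q.1 :=
  congrArg (Quot.map (ra := Γ.covS S) (rb := Γ.adjS S) Prod.fst
    (fun _ _ ⟨e, he, h, _⟩ => ⟨e, he, h⟩)) h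

theorem dc_flip {Γ : SGraph V E} {S : Set E} {p q : V × ℤˣ} (h : Γ.dc S p q) :
    Γ.dc S (p.1, -p.2) (q.1, -q.2) :=
  congrArg (Quot.map (ra := Γ.covS S) (rb := Γ.covS S) (fun p => (p.1, -p.2))
    (fun p q ⟨e, he, h, h'⟩ => ⟨e, he, h, by simp [h']⟩)) h

theorem dc_mono {Γ : SGraph V E} {S T : Set E} (hST : S ⊆ T) {p q : V × ℤˣ} (h : Γ.dc S p q) :
    Γ.dc T p q :=
  congrArg (Quot.map (ra := Γ.covS S) (rb := Γ.covS T) id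
    (fun _ _ ⟨e, he, h⟩ => ⟨e, hST he, h⟩)) h

theorem cc_mono {Γ : SGraph V E} {S T : Set E} (hST : S ⊆ T) {p q : V} (h : Γ.cc S p q) :
    Γ.cc T p q :=
  congrArg (Quot.map (ra := Γ.adjS S) (rb := Γ.adjS T) id
    (fun _ _ ⟨e, he, h⟩ => ⟨e, hST he, h⟩)) h

theorem kS_anti (Γ : SGraph V E) [Finite V] {S T : Set E} (hST : S ⊆ T) : Γ.kS T ≤ Γ.kS S := by
  refine Nat.card_le_card_of_surjective (Quot.map (ra := Γ.adjS S) (rb := Γ.adjS T) id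
    (fun _ _ ⟨e, he, h⟩ => ⟨e, hST he, h⟩)) ?_
  rintro ⟨x⟩; exact ⟨Quot.mk _ x, rfl⟩

theorem dS_anti (Γ : SGraph V E) [Finite V] {S T : Set E} (hST : S ⊆ T) : Γ.dS T ≤ Γ.dS S := by
  refine Nat.card_le_card_of_surjective (Quot.map (ra := Γ.covS S) (rb := Γ.covS T) id
    (fun _ _ ⟨e, he, h⟩ => ⟨e, hST he, h⟩)) ?_
  rintro ⟨x⟩; exact ⟨Quot.mk _ x, rfl⟩

theorem kS_le_card (Γ : SGraph V E) [Finite V] (S : Set E) : Γ.kS S ≤ Nat.card V :=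
  Nat.card_le_card_of_surjective (Quot.mk _) Quot.mk_surjective

theorem exists_dc {Γ : SGraph V E} {S : Set E} {u v : V} (h : Γ.cc S u v) (s : ℤˣ) :
    Γ.dc S (u, s) (v, 1) ∨ Γ.dc S (u, s) (v, -1) := by
  have key : ∀ a b : V, Γ.adjS S a b →
      ({Quot.mk (Γ.covS S) (a, 1), Quot.mk (Γ.covS S) (a, -1)} : Set (Quot (Γ.covS S))) =
      {Quot.mk (Γ.covS S) (b, 1), Quot.mk (Γ.covS S) (b, -1)} := by
    rintro a b ⟨e, he, h⟩
    rcases Int.units_eq_one_or (Γ.sign e) with hs | hs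
    · have h1 : Quot.mk (Γ.covS S) (a, 1) = Quot.mk _ (b, 1) :=
        Quot.sound ⟨e, he, h, by simp [hs]⟩
      have h2 : Quot.mk (Γ.covS S) (a, -1) = Quot.mk _ (b, -1) :=
        Quot.sound ⟨e, he, h, by simp [hs]⟩
      rw [h1, h2]
    · have h1 : Quot.mk (Γ.covS S) (a, 1) = Quot.mk _ (b, -1) :=
        Quot.sound ⟨e, he, h, by simp [hs]⟩
      have h2 : Quot.mk (Γ.covS S) (a, -1) = Quot.mk _ (b, 1) :=
        Quot.sound ⟨e, he, h, by simp [hs]⟩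
      rw [h1, h2, Set.pair_comm]
  have h2 := congrArg (Quot.lift _ key) h
  have h3 : Quot.mk (Γ.covS S) (u, s) ∈
      ({Quot.mk (Γ.covS S) (u, 1), Quot.mk (Γ.covS S) (u, -1)} : Set (Quot (Γ.covS S))) := by
    rcases Int.units_eq_one_or s with rfl | rfl <;> simp
  change ({Quot.mk (Γ.covS S) (u, 1), Quot.mk (Γ.covS S) (u, -1)} : Set (Quot (Γ.covS S))) = 
    {Quot.mk (Γ.covS S) (v, 1), Quot.mk (Γ.covS S) (v, -1)} at h2
  rw [h2] at h3
  exact h3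

/-- unbalanced at `a` -/
def ub (Γ : SGraph V E) (S : Set E) (a : V) : Prop := Γ.dc S (a, 1) (a, -1)

theorem adjS_insert (Γ : SGraph V E) (S : Set E) (e : E) :
    Γ.adjS (insert e S) = rqAdd (Γ.adjS S) (Γ.ends e).1 (Γ.ends e).2 := by
  funext a b
  apply propext
  constructor
  · rintro ⟨e', rfl | he, h⟩
    · right; rw [h]; exact ⟨rfl, rfl⟩
    · left; exact ⟨e', he, h⟩
  · rintro (⟨e', he, h⟩ | ⟨rfl, rfl⟩)
    · exact ⟨e', Or.inr he, h⟩
    · exact ⟨e, Or.inl rfl, rfl⟩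

theorem covS_insert (Γ : SGraph V E) (S : Set E) (e : E) :
    Γ.covS (insert e S) = rqAdd (rqAdd (Γ.covS S) ((Γ.ends e).1, 1) ((Γ.ends e).2, Γ.sign e))
      ((Γ.ends e).1, -1) ((Γ.ends e).2, -Γ.sign e) := by
  funext p q
  obtain ⟨a, s⟩ := p
  obtain ⟨b, t⟩ := q
  apply propext
  constructor
  · rintro ⟨e', rfl | he, h, h'⟩
    · simp only at h h'
      subst h'
      rcases Int.units_eq_one_or s with rfl | rfl
      · left; right; simp [h]
      · right; simp [h]
    · left; left; exact ⟨e', he, h, h'⟩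
  · rintro ((⟨e', he, h⟩ | ⟨h1, h2⟩) | ⟨h1, h2⟩)
    · exact ⟨e', Or.inr he, h⟩
    · cases h1; cases h2; exact ⟨e, Or.inl rfl, rfl, by simp⟩
    · cases h1; cases h2; exact ⟨e, Or.inl rfl, rfl, by simp⟩

section steps
variable (Γ : SGraph V E) [Finite V] (S : Set E) (e : E)

theorem kS_insert_cc (h : Γ.cc S (Γ.ends e).1 (Γ.ends e).2) : Γ.kS S = Γ.kS (insert e S) := by
  unfold kS; rw [adjS_insert]; exact rq_add_card_same _ _ _ h

theorem kS_insert_ncc (h : ¬ Γ.cc S (Γ.ends e).1 (Γ.ends e).2) :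
    Γ.kS S = Γ.kS (insert e S) + 1 := by
  unfold kS; rw [adjS_insert]; exact rq_add_card_diff _ _ _ h

theorem dS_insert_dc (h : Γ.dc S ((Γ.ends e).1, 1) ((Γ.ends e).2, Γ.sign e)) :
    Γ.dS S = Γ.dS (insert e S) := by
  unfold dS; rw [covS_insert, rq_add_card_same _ _ _ h]
  exact rq_add_card_same _ _ _ (rq_add_mono (dc_flip h))

theorem dS_insert_cc_ndc (hc : Γ.cc S (Γ.ends e).1 (Γ.ends e).2)
    (h : ¬ Γ.dc S ((Γ.ends e).1, 1) ((Γ.ends e).2, Γ.sign e)) :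
    Γ.dS S = Γ.dS (insert e S) + 1 := by
  unfold dS; rw [covS_insert, rq_add_card_diff _ _ _ h]
  congr 1
  apply rq_add_card_same
  have h1 : Γ.dc S ((Γ.ends e).1, 1) ((Γ.ends e).2, -Γ.sign e) := by
    rcases exists_dc hc 1 with h2 | h2 <;>
    rcases Int.units_eq_one_or (Γ.sign e) with hs | hs <;> rw [hs] at h ⊢
    · exact absurd h2 h
    · simpa using h2
    · exact h2
    · exact absurd h2 h
  have h2 := dc_flip h1
  simp only [neg_neg] at h2
  rw [rq_add_iff]
  right; right
  exact ⟨h2, h1⟩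

theorem dS_insert_ncc_ub (hc : ¬ Γ.cc S (Γ.ends e).1 (Γ.ends e).2)
    (h1 : Γ.ub S (Γ.ends e).1) (h2 : Γ.ub S (Γ.ends e).2) :
    Γ.dS S = Γ.dS (insert e S) + 1 := by
  unfold dS; rw [covS_insert, rq_add_card_diff _ _ _ (fun h => hc (cc_of_dc (p := (_, _)) (q := (_, _)) h))]
  congr 1
  apply rq_add_card_same
  rw [rq_add_iff]
  right; left
  refine ⟨Eq.symm h1, ?_⟩
  rcases Int.units_eq_one_or (Γ.sign e) with hs | hs <;> rw [hs]
  · exact h2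
  · simpa using Eq.symm h2

theorem dS_insert_ncc_nub (hc : ¬ Γ.cc S (Γ.ends e).1 (Γ.ends e).2)
    (h1 : ¬ (Γ.ub S (Γ.ends e).1 ∧ Γ.ub S (Γ.ends e).2)) :
    Γ.dS S = Γ.dS (insert e S) + 2 := by
  unfold dS; rw [covS_insert, rq_add_card_diff _ _ _ (fun h => hc (cc_of_dc (p := (_, _)) (q := (_, _)) h)), 
    rq_add_card_diff (rqAdd _ _ _)]
  intro h
  rw [rq_add_iff] at h
  rcases h with h | ⟨h, h'⟩ | ⟨h, h'⟩
  · exact hc (cc_of_dc h)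
  · refine h1 ⟨Eq.symm h, ?_⟩
    rcases Int.units_eq_one_or (Γ.sign e) with hs | hs <;> rw [hs] at h'
    · exact h'
    · simp only [neg_neg] at h'
      exact Eq.symm h'
  · exact hc (cc_of_dc h)

end steps

theorem kS_empty (Γ : SGraph V E) : Γ.kS ∅ = Nat.card V := by
  refine (Nat.card_congr (Equiv.ofBijective (Quot.mk _) ⟨?_, Quot.mk_surjective⟩)).symm
  intro a b h
  exact congrArg (Quot.lift id (by rintro a b ⟨e, he, _⟩; exact absurd he (by simp))) h

theorem dS_empty (Γ : SGraph V E) : Γ.dS ∅ = 2 * Nat.card V := by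
  have : Nat.card (V × ℤˣ) = Γ.dS ∅ := by
    refine (Nat.card_congr (Equiv.ofBijective (Quot.mk _) ⟨?_, Quot.mk_surjective⟩))
    intro a b h
    exact congrArg (Quot.lift id (by rintro a b ⟨e, he, _⟩; exact absurd he (by simp))) h
  rw [← this, Nat.card_prod, Nat.card_eq_fintype_card (α := ℤˣ)]
  simp [mul_comm]

theorem rank_le (Γ : SGraph V E) [Finite V] (A : Finset E) :
    Nat.card V + Γ.kS A ≤ A.card + Γ.dS A := by
  induction A using Finset.induction_on with
  | empty => simp only [Finset.coe_empty, kS_empty, dS_empty, Finset.card_empty]; omega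
  | insert e A he ih =>
    rw [Finset.card_insert_of_notMem he, Finset.coe_insert]
    by_cases hc : Γ.cc A (Γ.ends e).1 (Γ.ends e).2
    · have h1 := Γ.kS_insert_cc A e hc
      by_cases hd : Γ.dc A ((Γ.ends e).1, 1) ((Γ.ends e).2, Γ.sign e)
      · have h2 := Γ.dS_insert_dc A e hd
        omega
      · have h2 := Γ.dS_insert_cc_ndc A e hc hd
        omega
    · have h1 := Γ.kS_insert_ncc A e hc
      by_cases hd : Γ.ub A (Γ.ends e).1 ∧ Γ.ub A (Γ.ends e).2
      · have h2 := Γ.dS_insert_ncc_ub A e hc hd.1 hd.2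
        omega
      · have h2 := Γ.dS_insert_ncc_nub A e hc hd
        omega

/-! transport -/

theorem kAll_eq_kS (Γ : SGraph V E) : Γ.kAll = Γ.kS Set.univ := by
  refine rq_card_eq (fun x => Quot.mk _ x) (fun x => Quot.mk _ x) ?_ ?_ (fun _ => rfl) (fun _ => rfl)
  · rintro a b ⟨e, h | h⟩
    · exact Quot.sound ⟨e, trivial, h⟩
    · exact (Quot.sound ⟨e, trivial, h⟩).symm
  · rintro a b ⟨e, -, h⟩
    exact Quot.sound ⟨e, Or.inl h⟩

theorem adjS_map {E' : Type*} (Γ : SGraph V E) (Δ : SGraph V E') (ι : E' → E)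
    (h1 : ∀ e, Δ.ends e = Γ.ends (ι e)) (S : Set E') : Δ.adjS S = Γ.adjS (ι '' S) := by
  funext a b
  simp [adjS, h1]

theorem covS_map {E' : Type*} (Γ : SGraph V E) (Δ : SGraph V E') (ι : E' → E)
    (h1 : ∀ e, Δ.ends e = Γ.ends (ι e)) (h2 : ∀ e, Δ.sign e = Γ.sign (ι e)) (S : Set E') :
    Δ.covS S = Γ.covS (ι '' S) := by
  funext a b
  simp [covS, h1, h2]

theorem kS_restrict (Γ : SGraph V E) (A : Set E) : (Γ.restrict A).kS Set.univ = Γ.kS A := by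
  unfold kS; rw [adjS_map Γ _ Subtype.val (fun _ => rfl)]; simp
theorem dS_restrict (Γ : SGraph V E) (A : Set E) : (Γ.restrict A).dS Set.univ = Γ.dS A := by
  unfold dS; rw [covS_map Γ _ Subtype.val (fun _ => rfl) (fun _ => rfl)]; simp
theorem kS_delete (Γ : SGraph V E) (e : E) (B : Set _) :
    (Γ.deleteEdge e).kS B = Γ.kS (Subtype.val '' B) := by
  unfold kS; rw [adjS_map Γ _ Subtype.val (fun _ => rfl)]
theorem dS_delete (Γ : SGraph V E) (e : E) (B : Set _) :
    (Γ.deleteEdge e).dS B = Γ.dS (Subtype.val '' B) := by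
  unfold dS; rw [covS_map Γ _ Subtype.val (fun _ => rfl) (fun _ => rfl)]

theorem kS_contract (Γ : SGraph V E) (e : E) (B : Set _) :
    (Γ.contract e).kS B = Γ.kS (insert e (Subtype.val '' B)) := by
  refine rq_card_eq (Quot.lift (fun v => Quot.mk _ v) ?_) (fun v => Quot.mk _ (Quot.mk _ v))
    ?_ ?_ ?_ ?_
  · intro a b h
    exact Quot.sound ⟨e, by simp, h.symm⟩
  · rintro a b ⟨e', he', h⟩
    simp only [contract, Prod.mk.injEq] at h
    obtain ⟨rfl, rfl⟩ := h
    exact Quot.sound ⟨e'.1, Or.inr ⟨e', he', rfl⟩, rfl⟩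
  · rintro a b ⟨e', rfl | ⟨e'', he, rfl⟩, h⟩
    · exact congrArg (Quot.mk _) (Quot.sound h.symm)
    · exact Quot.sound ⟨e'', he, by simp [contract, h]⟩
  · rintro ⟨v⟩; rfl
  · intro v; rfl

theorem dS_contract (Γ : SGraph V E) (e : E) (hs : Γ.sign e = 1) (B : Set _) :
    (Γ.contract e).dS B = Γ.dS (insert e (Subtype.val '' B)) := by
  have h0 : ∀ (t : ℤˣ) (a b : V), Γ.contractRel e a b →
      Quot.mk (Γ.covS (insert e (Subtype.val '' B))) (a, t) = Quot.mk _ (b, t) := by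
    intro t a b h
    exact Quot.sound ⟨e, by simp, h.symm, by simp [hs]⟩
  refine rq_card_eq (fun p => Quot.lift (fun v => Quot.mk _ (v, p.2)) (h0 p.2) p.1)
    (fun v => Quot.mk _ (Quot.mk _ v.1, v.2))
    ?_ ?_ ?_ ?_
  · rintro ⟨a, s⟩ ⟨b, t⟩ ⟨e', he', h, h'⟩
    simp only [contract, Prod.mk.injEq] at h h'
    obtain ⟨rfl, rfl⟩ := h
    exact Quot.sound ⟨e'.1, Or.inr ⟨e', he', rfl⟩, rfl, h'⟩
  · rintro ⟨a, s⟩ ⟨b, t⟩ ⟨e', rfl | ⟨e'', he, rfl⟩, h, h'⟩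
    · simp only [hs, one_mul] at h'
      subst h'
      exact congrArg (fun z => Quot.mk _ (z, t)) (Quot.sound h.symm)
    · exact Quot.sound ⟨e'', he, by simp [contract, h], h'⟩
  · rintro ⟨⟨v⟩, s⟩; rfl
  · intro v; rfl

theorem card_contract (Γ : SGraph V E) [Finite V] (e : E) (h : ¬ Γ.IsLoop e) :
    Nat.card V = Nat.card (Quot (Γ.contractRel e)) + 1 := by
  have h1 := Γ.kS_insert_ncc ∅ e (by
    intro h2
    exact h (congrArg (Quot.lift id (by rintro a b ⟨e, he, _⟩; exact absurd he (by simp))) h2))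
  have h2 := Γ.kS_contract e ∅
  rw [kS_empty] at h1 h2
  rw [h2, h1]; simp

theorem kS_iso {V₁ E₁ V₂ E₂ : Type*} {Γ₁ : SGraph V₁ E₁} {Γ₂ : SGraph V₂ E₂}
    (φ : V₁ ≃ V₂) (ψ : E₁ ≃ E₂) (h : ∀ e : E₁,
    (Γ₂.ends (ψ e) = (φ (Γ₁.ends e).1, φ (Γ₁.ends e).2) ∨
      Γ₂.ends (ψ e) = (φ (Γ₁.ends e).2, φ (Γ₁.ends e).1)))
    (S : Set E₁) : Γ₁.kS S = Γ₂.kS (ψ '' S) := by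
  refine rq_card_eq (fun x => Quot.mk _ (φ x)) (fun x => Quot.mk _ (φ.symm x)) ?_ ?_ ?_ ?_
  · rintro a b ⟨e, he, h1⟩
    have := h e
    rw [h1] at this
    rcases this with h2 | h2
    · exact Quot.sound ⟨_, ⟨e, he, rfl⟩, h2⟩
    · exact (Quot.sound ⟨_, ⟨e, he, rfl⟩, h2⟩).symm
  · rintro a b ⟨_, ⟨e, he, rfl⟩, h1⟩
    have := h e
    rw [h1] at this
    simp only [Prod.mk.injEq] at this
    rcases this with ⟨rfl, rfl⟩ | ⟨rfl, rfl⟩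
    · exact Quot.sound ⟨e, he, by simp⟩
    · exact (Quot.sound ⟨e, he, by simp⟩).symm
  · intro x; simp
  · intro x; simp

theorem dS_iso {V₁ E₁ V₂ E₂ : Type*} {Γ₁ : SGraph V₁ E₁} {Γ₂ : SGraph V₂ E₂}
    (φ : V₁ ≃ V₂) (ψ : E₁ ≃ E₂) (h : ∀ e : E₁,
    (Γ₂.ends (ψ e) = (φ (Γ₁.ends e).1, φ (Γ₁.ends e).2) ∨
      Γ₂.ends (ψ e) = (φ (Γ₁.ends e).2, φ (Γ₁.ends e).1)) ∧ Γ₂.sign (ψ e) = Γ₁.sign e)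
    (S : Set E₁) : Γ₁.dS S = Γ₂.dS (ψ '' S) := by
  refine rq_card_eq (fun x => Quot.mk _ (φ x.1, x.2)) (fun x => Quot.mk _ (φ.symm x.1, x.2))
    ?_ ?_ ?_ ?_
  · rintro ⟨a, s⟩ ⟨b, t⟩ ⟨e, he, h1, h1'⟩
    have := h e
    rw [h1] at this
    simp only at h1'
    rcases this with ⟨h2 | h2, h3⟩
    · exact Quot.sound ⟨_, ⟨e, he, rfl⟩, h2, by simp [h3, h1']⟩
    · exact (Quot.sound ⟨_, ⟨e, he, rfl⟩, h2, by
        simp only [h3, h1', ← mul_assoc, Int.units_mul_self, one_mul]⟩).symm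
  · rintro ⟨a, s⟩ ⟨b, t⟩ ⟨_, ⟨e, he, rfl⟩, h1, h1'⟩
    have := h e
    rw [h1] at this
    simp only [Prod.mk.injEq] at this h1'
    rcases this with ⟨⟨rfl, rfl⟩ | ⟨rfl, rfl⟩, h3⟩
    · exact Quot.sound ⟨e, he, by simp, by simp [h1', h3]⟩
    · exact (Quot.sound ⟨e, he, by simp, by
        simp only [h3, h1', ← mul_assoc, Int.units_mul_self, one_mul]⟩).symm
  · intro x; simp
  · intro x; simp

theorem kS_switch (Γ : SGraph V E) (U : Set V) (S : Set E) : (Γ.switchSet U).kS S = Γ.kS S := rfl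

theorem dS_switch (Γ : SGraph V E) (U : Set V) (S : Set E) : (Γ.switchSet U).dS S = Γ.dS S := by
  let τ : V → ℤˣ := fun v => if v ∈ U then -1 else 1
  have hτ : ∀ v, τ v * τ v = 1 := fun v => Int.units_mul_self _
  have hs : ∀ e, (Γ.switchSet U).sign e = τ (Γ.ends e).1 * τ (Γ.ends e).2 * Γ.sign e := by
    intro e
    by_cases h1 : (Γ.ends e).1 ∈ U <;> by_cases h2 : (Γ.ends e).2 ∈ U <;>
      simp [switchSet, τ, h1, h2]
  refine rq_card_eq (fun x => Quot.mk _ (x.1, τ x.1 * x.2)) (fun x => Quot.mk _ (x.1, τ x.1 * x.2))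
    ?_ ?_ ?_ ?_
  · rintro ⟨a, s⟩ ⟨b, t⟩ ⟨e, he, h1, h2⟩
    change Γ.ends e = _ at h1
    rw [hs, h1] at h2
    refine Quot.sound ⟨e, he, h1, ?_⟩
    simp only at h2 ⊢
    rw [h2]
    calc _ = (τ b * τ b) * (τ a * Γ.sign e * s) := by ac_rfl
      _ = _ := by rw [hτ, one_mul]; ac_rfl
  · rintro ⟨a, s⟩ ⟨b, t⟩ ⟨e, he, h1, h2⟩
    refine Quot.sound ⟨e, he, h1, ?_⟩
    rw [hs, h1]
    simp only at h2 ⊢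
    rw [h2]
    calc _ = (τ b * (Γ.sign e * s)) := by ac_rfl
      _ = (τ a * τ a) * (τ b * (Γ.sign e * s)) := by rw [hτ, one_mul]
      _ = _ := by ac_rfl
  · rintro ⟨a, s⟩
    simp only [← mul_assoc, hτ, one_mul]
  · rintro ⟨a, s⟩
    simp only [← mul_assoc, hτ, one_mul]

theorem kS_disj {V₁ E₁ V₂ E₂ : Type*} [Finite V₁] [Finite V₂] (Γ₁ : SGraph V₁ E₁)
    (Γ₂ : SGraph V₂ E₂) (S : Set E₁) (T : Set E₂) :
    (Γ₁.disjUnion Γ₂).kS (Sum.inl '' S ∪ Sum.inr '' T) = Γ₁.kS S + Γ₂.kS T := by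
  unfold kS
  rw [← Nat.card_sum]
  refine Nat.card_congr ⟨Quot.lift (Sum.elim (fun v => Sum.inl (Quot.mk _ v))
      (fun v => Sum.inr (Quot.mk _ v))) ?_,
    Sum.elim (Quot.lift (fun v => Quot.mk _ (Sum.inl v)) ?_)
      (Quot.lift (fun v => Quot.mk _ (Sum.inr v)) ?_), ?_, ?_⟩
  · rintro a b ⟨_, ⟨e, he, rfl⟩ | ⟨e, he, rfl⟩, h⟩ <;> simp only [disjUnion, Prod.mk.injEq] at h <;>
      obtain ⟨rfl, rfl⟩ := h
    · exact congrArg Sum.inl (Quot.sound ⟨e, he, rfl⟩)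
    · exact congrArg Sum.inr (Quot.sound ⟨e, he, rfl⟩)
  · rintro a b ⟨e, he, h⟩
    exact Quot.sound ⟨Sum.inl e, Or.inl ⟨e, he, rfl⟩, by simp [disjUnion, h]⟩
  · rintro a b ⟨e, he, h⟩
    exact Quot.sound ⟨Sum.inr e, Or.inr ⟨e, he, rfl⟩, by simp [disjUnion, h]⟩
  · rintro ⟨a | a⟩ <;> rfl
  · rintro (a | a) <;> induction a using Quot.ind <;> rfl

theorem dS_disj {V₁ E₁ V₂ E₂ : Type*} [Finite V₁] [Finite V₂] (Γ₁ : SGraph V₁ E₁)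
    (Γ₂ : SGraph V₂ E₂) (S : Set E₁) (T : Set E₂) :
    (Γ₁.disjUnion Γ₂).dS (Sum.inl '' S ∪ Sum.inr '' T) = Γ₁.dS S + Γ₂.dS T := by
  unfold dS
  rw [← Nat.card_sum]
  refine Nat.card_congr ⟨Quot.lift (fun p => Sum.elim (fun v => Sum.inl (Quot.mk _ (v, p.2)))
      (fun v => Sum.inr (Quot.mk _ (v, p.2))) p.1) ?_,
    Sum.elim (Quot.lift (fun v => Quot.mk _ (Sum.inl v.1, v.2)) ?_)
      (Quot.lift (fun v => Quot.mk _ (Sum.inr v.1, v.2)) ?_), ?_, ?_⟩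
  · rintro ⟨a, s⟩ ⟨b, t⟩ ⟨_, ⟨e, he, rfl⟩ | ⟨e, he, rfl⟩, h, h'⟩ <;>
      simp only [disjUnion, Prod.mk.injEq] at h <;>
      obtain ⟨rfl, rfl⟩ := h
    · exact congrArg Sum.inl (Quot.sound ⟨e, he, rfl, h'⟩)
    · exact congrArg Sum.inr (Quot.sound ⟨e, he, rfl, h'⟩)
  · rintro a b ⟨e, he, h, h'⟩
    exact Quot.sound ⟨Sum.inl e, Or.inl ⟨e, he, rfl⟩, by simp [disjUnion, h], h'⟩
  · rintro a b ⟨e, he, h, h'⟩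
    exact Quot.sound ⟨Sum.inr e, Or.inr ⟨e, he, rfl⟩, by simp [disjUnion, h], h'⟩
  · rintro ⟨a | a, s⟩ <;> rfl
  · rintro (a | a) <;> induction a using Quot.ind <;> rfl

end SGraph
end Recipe

noncomputable section Recipe2
open SGraph
namespace SGraph
variable {V E : Type*} {Γ : SGraph V E}

namespace Walk

@[simp] theorem srcs_nil (v : V) : (Walk.nil v : Γ.Walk v v).srcs = [] := rfl

theorem verts_ne_nil {u v : V} (W : Γ.Walk u v) : W.verts ≠ [] := by
  cases W <;> simp [verts]

@[simp] theorem srcs_cons (e : E) (d : Bool) {w : V} (p : Γ.Walk (Γ.endpt e (!d)) w) :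
    (Walk.cons e d p).srcs = Γ.endpt e d :: p.srcs := by
  simp [srcs, verts, List.dropLast_cons_of_ne_nil (verts_ne_nil p)]

theorem start_mem {u v : V} (W : Γ.Walk u v) : u ∈ W.verts := by
  cases W <;> simp [verts]

theorem verts_eq {u v : V} (W : Γ.Walk u v) : W.verts = W.srcs ++ [v] := by
  induction W with
  | nil v => rfl
  | cons e d p ih => rw [srcs_cons, verts, ih]; rfl

theorem edges_append {u v w : V} (P : Γ.Walk u v) (Q : Γ.Walk v w) :
    (P.append Q).edges = P.edges ++ Q.edges := by
  induction P with
  | nil v => rfl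
  | cons e d p ih => simp [append, edges, ih]

theorem sgn_append {u v w : V} (P : Γ.Walk u v) (Q : Γ.Walk v w) :
    (P.append Q).sgn = P.sgn * Q.sgn := by
  induction P with
  | nil v => simp [append, sgn]
  | cons e d p ih => simp [append, sgn, ih, mul_assoc]

theorem srcs_append {u v w : V} (P : Γ.Walk u v) (Q : Γ.Walk v w) :
    (P.append Q).srcs = P.srcs ++ Q.srcs := by
  induction P with
  | nil v => rfl
  | cons e d p ih => simp [append, ih]

/-- split at a source -/
theorem split_src {u v : V} (W : Γ.Walk u v) {x : V} (hx : x ∈ W.srcs) :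
    ∃ (A : Γ.Walk u x) (B : Γ.Walk x v), W = A.append B ∧ B.edges ≠ [] := by
  induction W with
  | nil v => simp at hx
  | cons e d p ih =>
    rw [srcs_cons, List.mem_cons] at hx
    rcases hx with rfl | hx
    · exact ⟨.nil _, .cons e d p, rfl, by simp [edges]⟩
    · obtain ⟨A, B, rfl, hB⟩ := ih hx
      exact ⟨.cons e d A, B, rfl, hB⟩

theorem split_vert {u v : V} (W : Γ.Walk u v) {x : V} (hx : x ∈ W.verts) :
    ∃ (A : Γ.Walk u x) (B : Γ.Walk x v), W = A.append B := by
  rw [verts_eq, List.mem_append, List.mem_singleton] at hx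
  rcases hx with hx | rfl
  · obtain ⟨A, B, h, _⟩ := W.split_src hx
    exact ⟨A, B, h⟩
  · refine ⟨W, .nil _, ?_⟩
    induction W with
    | nil v => rfl
    | cons e d p ih => simp only [append]; rw [← ih]

theorem dup_src {u v : V} (W : Γ.Walk u v) (h : ¬ W.srcs.Nodup) :
    ∃ (x : V) (A : Γ.Walk u x) (B : Γ.Walk x x) (C : Γ.Walk x v),
      W = A.append (B.append C) ∧ B.edges ≠ [] ∧ C.edges ≠ [] := by
  induction W with
  | nil v => simp at h
  | cons e d p ih =>
    by_cases h1 : Γ.endpt e d ∈ p.srcs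
    · obtain ⟨A, B, h, hB⟩ := p.split_src h1
      subst h
      exact ⟨_, .nil _, .cons e d A, B, rfl, by simp [edges], hB⟩
    · have : ¬ p.srcs.Nodup := by
        intro h2; apply h; rw [srcs_cons]; exact List.nodup_cons.2 ⟨h1, h2⟩
      obtain ⟨x, A, B, C, rfl, h1, h2⟩ := ih this
      exact ⟨x, .cons e d A, B, C, rfl, h1, h2⟩

theorem dup_vert {u v : V} (W : Γ.Walk u v) (h : ¬ W.verts.Nodup) :
    ∃ (x : V) (A : Γ.Walk u x) (B : Γ.Walk x x) (C : Γ.Walk x v),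
      W = A.append (B.append C) ∧ B.edges ≠ [] := by
  induction W with
  | nil v => simp [verts] at h
  | cons e d p ih =>
    by_cases h1 : Γ.endpt e d ∈ p.verts
    · obtain ⟨A, B, h⟩ := p.split_vert h1
      subst h
      exact ⟨_, .nil _, .cons e d A, B, rfl, by simp [edges]⟩
    · have : ¬ p.verts.Nodup := by
        intro h2; apply h; rw [verts]; exact List.nodup_cons.2 ⟨h1, h2⟩
      obtain ⟨x, A, B, C, rfl, h2⟩ := ih this
      exact ⟨x, .cons e d A, B, C, rfl, h2⟩

theorem split_edge {u v : V} (W : Γ.Walk u v) {e : E} (he : e ∈ W.edges) :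
    ∃ (d : Bool) (A : Γ.Walk u (Γ.endpt e d)) (B : Γ.Walk (Γ.endpt e (!d)) v),
      W = A.append (.cons e d B) := by
  induction W with
  | nil v => simp [edges] at he
  | cons e' d p ih =>
    by_cases h : e = e'
    · subst h; exact ⟨d, .nil _, p, rfl⟩
    · have : e ∈ p.edges := by simpa [edges, h] using he
      obtain ⟨d', A, B, rfl⟩ := ih this
      exact ⟨d', .cons e' d A, B, rfl⟩

theorem dup_edge {u v : V} (W : Γ.Walk u v) (h : ¬ W.edges.Nodup) :
    ∃ (e : E) (d d' : Bool) (A : Γ.Walk u (Γ.endpt e d))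
      (B : Γ.Walk (Γ.endpt e (!d)) (Γ.endpt e d')) (C : Γ.Walk (Γ.endpt e (!d')) v),
      W = A.append (.cons e d (B.append (.cons e d' C))) := by
  induction W with
  | nil v => simp [edges] at h
  | cons e d p ih =>
    by_cases h1 : e ∈ p.edges
    · obtain ⟨d', A, B, rfl⟩ := p.split_edge h1
      exact ⟨e, d, d', .nil _, A, B, rfl⟩
    · have : ¬ p.edges.Nodup := by
        intro h2; apply h; rw [edges]; exact List.nodup_cons.2 ⟨h1, h2⟩
      obtain ⟨e', d', d'', A, B, C, rfl⟩ := ih this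
      exact ⟨e', d', d'', .cons e d A, B, C, rfl⟩

theorem edge_verts {u v : V} (W : Γ.Walk u v) {e : E} (he : e ∈ W.edges) (b : Bool) :
    Γ.endpt e b ∈ W.verts := by
  obtain ⟨d, A, B, rfl⟩ := W.split_edge he
  rw [verts_eq, srcs_append, srcs_cons]
  by_cases h : b = d
  · subst h; simp
  · have : b = !d := by cases b <;> cases d <;> simp_all
    subst this
    have : Γ.endpt e (!d) ∈ B.verts := B.start_mem
    rw [verts_eq] at this
    simp only [List.mem_append, List.mem_cons] at this ⊢
    tauto

/-- endpoints of an edge of a closed walk are sources -/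
theorem edge_srcs {v : V} (W : Γ.Walk v v) {e : E} (he : e ∈ W.edges) (b : Bool) :
    Γ.endpt e b ∈ W.srcs := by
  have h := W.edge_verts he b
  rw [verts_eq, List.mem_append, List.mem_singleton] at h
  rcases h with h | h
  · exact h
  · rw [h]
    cases W with
    | nil => simp [edges] at he
    | cons e d p => simp

theorem exists_reverse {u v : V} (W : Γ.Walk u v) :
    ∃ W' : Γ.Walk v u, W'.sgn = W.sgn ∧ ∀ e ∈ W'.edges, e ∈ W.edges := by
  induction W with
  | nil v => exact ⟨.nil v, rfl, fun _ h => h⟩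
  | @cons e d w p ih =>
    obtain ⟨q, h1, h2⟩ := ih
    have : ∃ r : Γ.Walk (Γ.endpt e (!d)) (Γ.endpt e d), r.sgn = Γ.sign e ∧ r.edges = [e] := by
      cases d
      · exact ⟨.cons e true (.nil _), by simp [sgn], rfl⟩
      · exact ⟨.cons e false (.nil _), by simp [sgn], rfl⟩
    obtain ⟨r, h3, h4⟩ := this
    refine ⟨q.append r, by rw [sgn_append, h1, h3, sgn, mul_comm], ?_⟩
    intro e' he'
    rw [edges_append, h4, List.mem_append, List.mem_singleton] at he'
    rw [edges, List.mem_cons]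
    rcases he' with h | h
    · exact Or.inr (h2 _ h)
    · exact Or.inl h

theorem to_dc {S : Set E} {u v : V} (W : Γ.Walk u v) (h : ∀ e ∈ W.edges, e ∈ S) (s : ℤˣ) :
    Γ.dc S (u, s) (v, W.sgn * s) := by
  induction W generalizing s with
  | nil v => simp [sgn, dc]
  | @cons e d w p ih =>
    have h1 := ih (fun e' he' => h e' (by simp [edges, he'])) (Γ.sign e * s)
    have he : e ∈ S := h e (by simp [edges])
    have h2 : Γ.dc S (Γ.endpt e d, s) (Γ.endpt e (!d), Γ.sign e * s) := by
      cases d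
      · exact (Quot.sound ⟨e, he, rfl, by simp [← mul_assoc]⟩ : Γ.dc S _ _).symm
      · exact Quot.sound ⟨e, he, rfl, rfl⟩
    have h3 : (Walk.cons e d p).sgn * s = p.sgn * (Γ.sign e * s) := by
      rw [sgn]; ac_rfl
    rw [h3]
    exact Eq.trans h2 h1

theorem of_gen {S : Set E} {p q : V × ℤˣ} (h' : Relation.EqvGen (Γ.covS S) p q) :
    ∃ W : Γ.Walk p.1 q.1, (∀ e ∈ W.edges, e ∈ S) ∧ q.2 = W.sgn * p.2 := by
  induction h' with
  | rel p q h =>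
    obtain ⟨a, s⟩ := p
    obtain ⟨b, t⟩ := q
    obtain ⟨e, he, h1, h2⟩ := h
    have ha : (Γ.ends e).1 = a := by rw [h1]
    have hb : (Γ.ends e).2 = b := by rw [h1]
    clear h1
    subst ha hb
    refine ⟨.cons e true (.nil _), ?_, ?_⟩
    · simpa [edges] using he
    · simpa [sgn] using h2
  | refl p => exact ⟨.nil _, by simp [edges], by simp [sgn]⟩
  | symm p q hpq ih =>
    obtain ⟨W, h1, h2⟩ := ih
    obtain ⟨W', h3, h4⟩ := W.exists_reverse
    refine ⟨W', fun e he => h1 e (h4 e he), ?_⟩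
    rw [h3, h2, ← mul_assoc, Int.units_mul_self, one_mul]
  | trans p q r hpq hqr ih1 ih2 =>
    obtain ⟨W, h1, h2⟩ := ih1
    obtain ⟨W', h3, h4⟩ := ih2
    refine ⟨W.append W', ?_, ?_⟩
    · intro e he
      rw [edges_append, List.mem_append] at he
      exact he.elim (h1 e) (h3 e)
    · rw [sgn_append, h4, h2]; ac_rfl

theorem of_dc {S : Set E} {p q : V × ℤˣ} (h : Γ.dc S p q) :
    ∃ W : Γ.Walk p.1 q.1, (∀ e ∈ W.edges, e ∈ S) ∧ q.2 = W.sgn * p.2 :=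
  of_gen (Quot.eqvGen_exact h)

/-- A negative closed walk contains a negative cycle. -/
theorem neg_cycle (n : ℕ) : ∀ {v : V} (W : Γ.Walk v v), W.edges.length = n → W.sgn = -1 →
    ∃ (u : V) (C : Γ.Walk u u), Γ.IsUnbalancedCycle C ∧ (∀ e ∈ C.edges, e ∈ W.edges) ∧
      u ∈ W.srcs := by
  induction n using Nat.strong_induction_on with
  | _ n ih =>
  intro v W hn hs
  have hne : W.edges ≠ [] := by
    cases W with
    | nil => simp [sgn] at hs
    | cons e d p => simp [edges]
  by_cases h1 : W.srcs.Nodup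
  · by_cases h2 : W.edges.Nodup
    · refine ⟨v, W, ⟨⟨hne, h1, h2⟩, hs⟩, fun _ h => h, ?_⟩
      cases W with
      | nil => simp [edges] at hne
      | cons e d p => simp
    · obtain ⟨e, d, d', A, B, C, rfl⟩ := W.dup_edge h2
      have hd : d' = !d := by
        by_contra hd
        have : d' = d := by cases d <;> cases d' <;> simp_all
        subst this
        simp only [srcs_append, srcs_cons] at h1
        rw [List.nodup_append, List.nodup_cons] at h1
        exact h1.2.1.1 (by simp)
      subst hd
      have key : ∀ (C' : Γ.Walk (Γ.endpt e d) v), C'.edges = C.edges → C'.sgn = C.sgn →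
          C'.srcs = C.srcs →
          ∃ (u : V) (C_1 : Γ.Walk u u), Γ.IsUnbalancedCycle C_1 ∧
          (∀ e_1 ∈ C_1.edges, e_1 ∈ (A.append (cons e d (B.append (cons e (!d) C)))).edges) ∧
          u ∈ (A.append (cons e d (B.append (cons e (!d) C)))).srcs := by
        intro C' he hsg hsr
        simp only [sgn_append, sgn] at hs
        simp only [edges_append, edges, List.length_append, List.length_cons] at hn
        have hs2 : B.sgn * (A.sgn * C.sgn) = -1 := by
          rw [← hs]
          calc _ = (Γ.sign e * Γ.sign e) * (B.sgn * (A.sgn * C.sgn)) := by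
                rw [Int.units_mul_self, one_mul]
            _ = _ := by ac_rfl
        rcases Int.units_eq_one_or B.sgn with hB | hB
        · rw [hB, one_mul] at hs2
          obtain ⟨u, D, h3, h4, h5⟩ := ih _ (by
            rw [edges_append, List.length_append, he]; omega) (A.append C') rfl
            (by rw [sgn_append, hsg, hs2])
          refine ⟨u, D, h3, ?_, ?_⟩
          · intro e' he'
            have := h4 e' he'
            simp only [edges_append, edges, he, List.mem_append, List.mem_cons] at this ⊢
            tauto
          · simp only [srcs_append, srcs_cons, hsr, List.mem_append, List.mem_cons] at h5 ⊢
            tauto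
        · obtain ⟨u, D, h3, h4, h5⟩ := ih _ (by omega) B rfl hB
          refine ⟨u, D, h3, ?_, ?_⟩
          · intro e' he'
            have := h4 e' he'
            simp only [edges_append, edges, List.mem_append, List.mem_cons] at this ⊢
            tauto
          · simp only [srcs_append, srcs_cons, List.mem_append, List.mem_cons] at h5 ⊢
            tauto
      cases d
      · exact key C rfl rfl rfl
      · exact key C rfl rfl rfl
  · obtain ⟨x, A, B, C, rfl, hB, hC⟩ := W.dup_src h1
    simp only [sgn_append] at hs
    simp only [edges_append, List.length_append] at hn
    have hB' := List.length_pos_iff.2 hB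
    have hC' := List.length_pos_iff.2 hC
    rcases Int.units_eq_one_or B.sgn with hBs | hBs
    · rw [hBs, one_mul] at hs
      obtain ⟨u, D, h3, h4, h5⟩ := ih _ (by
            rw [edges_append, List.length_append]; omega) (A.append C) rfl
            (by rw [sgn_append, hs])
      refine ⟨u, D, h3, ?_, ?_⟩
      · intro e' he'
        have := h4 e' he'
        simp only [edges_append, List.mem_append] at this ⊢
        tauto
      · simp only [srcs_append, List.mem_append] at h5 ⊢
        tauto
    · obtain ⟨u, D, h3, h4, h5⟩ := ih _ (by omega) B rfl hBs
      refine ⟨u, D, h3, ?_, ?_⟩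
      · intro e' he'
        have := h4 e' he'
        simp only [edges_append, List.mem_append] at this ⊢
        tauto
      · simp only [srcs_append, List.mem_append] at h5 ⊢
        tauto

end Walk

theorem cc_of_src {S : Set E} {u v x : V} (W : Γ.Walk u v) (h : ∀ e ∈ W.edges, e ∈ S)
    (hx : x ∈ W.verts) : Γ.cc S u x := by
  obtain ⟨A, B, rfl⟩ := W.split_vert hx
  exact cc_of_dc (p := (_, _)) (q := (_, _))
    (A.to_dc (fun e he => h e (by rw [Walk.edges_append]; simp [he])) 1)

theorem src_vert {u v x : V} (W : Γ.Walk u v) (hx : x ∈ W.srcs) : x ∈ W.verts := by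
  rw [Walk.verts_eq]; simp [hx]

/-- In an unbalanced component there is a negative cycle. -/
theorem ub_cycle {S : Set E} {a : V} (h : Γ.ub S a) :
    ∃ (u : V) (C : Γ.Walk u u), Γ.IsUnbalancedCycle C ∧ (∀ e ∈ C.edges, e ∈ S) ∧ Γ.cc S a u := by
  obtain ⟨W, h1, h2⟩ := Walk.of_dc h
  simp only [mul_one] at h2
  obtain ⟨u, C, h3, h4, h5⟩ := Walk.neg_cycle _ W rfl h2.symm
  exact ⟨u, C, h3, fun e he => h1 e (h4 e he), cc_of_src W h1 (src_vert W h5)⟩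

theorem ub_of_walk {S : Set E} {u : V} (C : Γ.Walk u u) (h : ∀ e ∈ C.edges, e ∈ S)
    (hs : C.sgn = -1) : Γ.ub S u := by
  have := C.to_dc h 1
  rw [hs] at this
  simpa [ub] using this

theorem ub_congr {S : Set E} {a b : V} (h : Γ.cc S a b) (hb : Γ.ub S b) : Γ.ub S a := by
  have h1 := hb
  rcases exists_dc h 1 with h2 | h2
  · exact Eq.trans h2 (Eq.trans h1 (Eq.symm (dc_flip h2)))
  · have h3 := dc_flip h2
    simp only [neg_neg] at h3
    exact Eq.trans h2 (Eq.trans (Eq.symm h1) (Eq.symm h3))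

theorem isBalanced_iff (v : V) : Γ.IsBalancedComponent (Γ.comp v) ↔ ¬ Γ.ub Set.univ v := by
  have hc : ∀ u w, Γ.comp u = Γ.comp w ↔ Γ.cc Set.univ u w := by
    intro u w
    constructor
    · intro h
      refine congrArg (Quot.lift (fun x => Quot.mk (Γ.adjS Set.univ) x) ?_) h
      rintro a b ⟨e, h | h⟩
      · exact Quot.sound ⟨e, trivial, h⟩
      · exact (Quot.sound ⟨e, trivial, h⟩).symm
    · intro h
      refine congrArg (Quot.lift (fun x => Γ.comp x) ?_) h
      rintro a b ⟨e, -, h⟩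
      exact Quot.sound ⟨e, Or.inl h⟩
  constructor
  · intro h hu
    obtain ⟨u, C, h1, h2, h3⟩ := ub_cycle hu
    have := h u ((hc _ _).2 h3).symm C h1.1
    rw [h1.2] at this
    exact absurd this (by decide)
  · intro h u hu W hW
    rcases Int.units_eq_one_or W.sgn with h1 | h1
    · exact h1
    · exact absurd (ub_congr (Eq.symm ((hc _ _).1 hu)) (ub_of_walk W (fun _ _ => trivial) h1)) h

theorem kAll_eq_add (Γ : SGraph V E) [Finite V] : Γ.kAll = Γ.kb + Γ.ku := by
  have : Finite Γ.Components := inferInstanceAs (Finite (Quot _))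
  have := Fintype.ofFinite Γ.Components
  unfold kAll kb ku
  rw [← Nat.card_sum]
  exact Nat.card_congr (Equiv.sumCompl _).symm

theorem dS_eq_add (Γ : SGraph V E) [Finite V] : Γ.dS Set.univ = 2 * Γ.kb + Γ.ku := by
  have hfin : Finite Γ.Components := inferInstanceAs (Finite (Quot _))
  let π : Quot (Γ.covS Set.univ) → Γ.Components :=
    Quot.lift (fun p => Γ.comp p.1) (fun p q ⟨e, _, h, _⟩ => Quot.sound ⟨e, Or.inl h⟩)
  have hcc : ∀ u w, Γ.comp u = Γ.comp w → Γ.cc Set.univ u w := by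
    intro u w h
    refine congrArg (Quot.lift (fun x => Quot.mk (Γ.adjS Set.univ) x) ?_) h
    rintro a b ⟨e, h | h⟩
    · exact Quot.sound ⟨e, trivial, h⟩
    · exact (Quot.sound ⟨e, trivial, h⟩).symm
  let f : {c : Γ.Components // Γ.IsBalancedComponent c} ⊕ Γ.Components → Quot (Γ.covS Set.univ) :=
    Sum.elim (fun c => Quot.mk _ (c.1.out, -1)) (fun c => Quot.mk _ (c.out, 1))
  have hout : ∀ c : Γ.Components, Γ.comp c.out = c := fun c => Quot.out_eq c
  have hb : Function.Bijective f := by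
    constructor
    · rintro (⟨c, hc⟩ | c) (⟨c', hc'⟩ | c') h
      · have := congrArg π h
        change Γ.comp _ = Γ.comp _ at this
        simp only [hout] at this
        subst this
        rfl
      · have := congrArg π h
        change Γ.comp _ = Γ.comp _ at this
        simp only [hout] at this
        subst this
        rw [← hout c, isBalanced_iff] at hc
        exact absurd (Eq.symm h) hc
      · have := congrArg π h
        change Γ.comp _ = Γ.comp _ at this
        simp only [hout] at this
        subst this
        rw [← hout c, isBalanced_iff] at hc'
        exact absurd h hc'
      · have := congrArg π h
        change Γ.comp _ = Γ.comp _ at this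
        simp only [hout] at this
        subst this
        rfl
    · rintro ⟨v, s⟩
      rcases exists_dc (hcc v (Γ.comp v).out (hout _).symm) s with h | h
      · exact ⟨Sum.inr (Γ.comp v), Eq.symm h⟩
      · by_cases hbal : Γ.IsBalancedComponent (Γ.comp v)
        · exact ⟨Sum.inl ⟨Γ.comp v, hbal⟩, Eq.symm h⟩
        · rw [← hout (Γ.comp v), isBalanced_iff, not_not] at hbal
          exact ⟨Sum.inr (Γ.comp v), Eq.trans hbal (Eq.symm h)⟩
  have := Nat.card_congr (Equiv.ofBijective f hb)
  rw [Nat.card_sum] at this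
  have h2 := Γ.kAll_eq_add
  change _ = Γ.dS Set.univ at this
  change Γ.kb + Γ.kAll = _ at this
  omega

theorem kS_le_dS (Γ : SGraph V E) [Finite V] (S : Set E) :
    Γ.kS S ≤ Γ.dS S ∧ Γ.dS S ≤ 2 * Γ.kS S := by
  have h1 := (Γ.restrict S).kAll_eq_add
  have h2 := (Γ.restrict S).dS_eq_add
  rw [kAll_eq_kS, kS_restrict] at h1
  rw [dS_restrict] at h2
  omega

theorem kb_eq (Γ : SGraph V E) [Finite V] : Γ.kb = Γ.dS Set.univ - Γ.kS Set.univ := by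
  have h1 := Γ.kAll_eq_add
  have h2 := Γ.dS_eq_add
  rw [kAll_eq_kS] at h1
  omega
theorem ku_eq (Γ : SGraph V E) [Finite V] : Γ.ku = 2 * Γ.kS Set.univ - Γ.dS Set.univ := by
  have h1 := Γ.kAll_eq_add
  have h2 := Γ.dS_eq_add
  rw [kAll_eq_kS] at h1
  omega

/-- rotate a cycle -/
theorem rotate_cycle {v x : V} (C : Γ.Walk v v) (h : Γ.IsUnbalancedCycle C) (hx : x ∈ C.srcs) :
    ∃ D : Γ.Walk x x, Γ.IsUnbalancedCycle D ∧ (∀ y, y ∈ D.srcs ↔ y ∈ C.srcs) ∧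
      (∀ e, e ∈ D.edges ↔ e ∈ C.edges) := by
  obtain ⟨A, B, rfl, hB⟩ := C.split_src hx
  refine ⟨B.append A, ⟨⟨?_, ?_, ?_⟩, ?_⟩, ?_, ?_⟩
  · rw [Walk.edges_append]; simp [hB]
  · have := h.1.2.1
    rw [Walk.srcs_append] at this ⊢
    exact List.nodup_append_comm.1 this
  · have := h.1.2.2
    rw [Walk.edges_append] at this ⊢
    exact List.nodup_append_comm.1 this
  · have := h.2
    rw [Walk.sgn_append] at this ⊢
    rw [mul_comm, this]
  · intro y; simp only [Walk.srcs_append, List.mem_append]; tauto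
  · intro y; simp only [Walk.edges_append, List.mem_append]; tauto

theorem endpt_cc {S : Set E} (e : E) (d : Bool) (h : Γ.cc S (Γ.endpt e d) (Γ.endpt e (!d))) :
    Γ.cc S (Γ.ends e).1 (Γ.ends e).2 := by
  cases d
  · exact Eq.symm h
  · exact h

/-- For an edge whose deletion disconnects its ends. -/
theorem cpe_iff (Γ : SGraph V E) (e : E) (hb : ¬ Γ.cc {e}ᶜ (Γ.ends e).1 (Γ.ends e).2) :
    Γ.IsCircuitPathEdge e ↔ Γ.ub {e}ᶜ (Γ.ends e).1 ∧ Γ.ub {e}ᶜ (Γ.ends e).2 := by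
  constructor
  · rintro ⟨u, w, C₁, P, C₂, ⟨h1, h2, h3, h4, h5, h6, h7⟩, he⟩
    have hu : Γ.ub {e}ᶜ u := ub_of_walk C₁ (fun e' he' h => (h7 e he).1 (by
      rw [Set.mem_singleton_iff] at h; rwa [← h])) h1.2
    have hw : Γ.ub {e}ᶜ w := ub_of_walk C₂ (fun e' he' h => (h7 e he).2 (by
      rw [Set.mem_singleton_iff] at h; rwa [← h])) h2.2
    obtain ⟨d, A, B, rfl⟩ := P.split_edge he
    have hnd := h3.2
    rw [Walk.verts_eq, Walk.srcs_append, Walk.srcs_cons, List.append_assoc,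
      List.cons_append, ← Walk.verts_eq, List.nodup_append, List.nodup_cons] at hnd
    obtain ⟨-, ⟨hn1, -⟩, hn2⟩ := hnd
    have hB : ∀ e' ∈ B.edges, e' ∈ ({e}ᶜ : Set E) := by
      intro e' he' h
      rw [Set.mem_singleton_iff] at h
      subst h
      exact hn1 (B.edge_verts he' d)
    have hA : ∀ e' ∈ A.edges, e' ∈ ({e}ᶜ : Set E) := by
      intro e' he' h
      rw [Set.mem_singleton_iff] at h
      subst h
      have := A.edge_verts he' (!d)
      rw [Walk.verts_eq, List.mem_append, List.mem_singleton] at this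
      rcases this with h | h
      · refine hn2 _ h _ ?_ rfl
        right
        exact B.start_mem
      · apply hn1
        rw [← h]
        exact B.start_mem
    have ha := ub_congr (Eq.symm (cc_of_dc (p := (_, _)) (q := (_, _)) (A.to_dc hA 1))) hu
    have hb := ub_congr (cc_of_dc (p := (_, _)) (q := (_, _)) (B.to_dc hB 1)) hw
    cases d
    · exact ⟨hb, ha⟩
    · exact ⟨ha, hb⟩
  · rintro ⟨ha, hb'⟩
    obtain ⟨v₁, C₁, h1, h2, h3⟩ := ub_cycle ha
    obtain ⟨v₂, C₂, h1', h2', h3'⟩ := ub_cycle hb'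
    have hsrc1 : ∀ x ∈ C₁.srcs, Γ.cc {e}ᶜ (Γ.ends e).1 x := fun x hx =>
      Eq.trans h3 (cc_of_src C₁ h2 (src_vert C₁ hx))
    have hsrc2 : ∀ x ∈ C₂.srcs, Γ.cc {e}ᶜ (Γ.ends e).2 x := fun x hx =>
      Eq.trans h3' (cc_of_src C₂ h2' (src_vert C₂ hx))
    have hsep : ∀ x ∈ C₁.srcs, ∀ y ∈ C₂.srcs, ¬ Γ.cc {e}ᶜ x y := fun x hx y hy h =>
      hb (Eq.trans (hsrc1 x hx) (Eq.trans h (Eq.symm (hsrc2 y hy))))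
    have hex : ∃ n, ∃ (x y : V) (P : Γ.Walk x y), x ∈ C₁.srcs ∧ y ∈ C₂.srcs ∧
        P.edges.length = n := by
      have hmem : ∀ (v : V) (C : Γ.Walk v v), Γ.IsCycle C → v ∈ C.srcs := by
        intro v C hC
        cases C with
        | nil => exact absurd rfl hC.1
        | cons e d p => simp
      have hcon : Γ.cc Set.univ v₁ v₂ := by
        refine Eq.trans (Eq.symm (cc_mono (Set.subset_univ _) h3))
          (Eq.trans ?_ (cc_mono (Set.subset_univ _) h3'))
        exact Quot.sound ⟨e, trivial, rfl⟩
      rcases exists_dc hcon 1 with h | h <;> obtain ⟨W, -, -⟩ := Walk.of_dc h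
      · exact ⟨_, v₁, v₂, W, hmem _ _ h1.1, hmem _ _ h1'.1, rfl⟩
      · exact ⟨_, v₁, v₂, W, hmem _ _ h1.1, hmem _ _ h1'.1, rfl⟩
    obtain ⟨x, y, P, hx, hy, hP⟩ := Nat.find_spec hex
    have hmin : ∀ (x' y' : V) (P' : Γ.Walk x' y'), x' ∈ C₁.srcs → y' ∈ C₂.srcs →
        P.edges.length ≤ P'.edges.length := by
      intro x' y' P' hx' hy'
      rw [hP]
      exact Nat.find_min' hex ⟨x', y', P', hx', hy', rfl⟩
    have heP : e ∈ P.edges := by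
      by_contra he
      have hP' : ∀ e' ∈ P.edges, e' ∈ ({e}ᶜ : Set E) := by
        intro e' he' h
        rw [Set.mem_singleton_iff] at h
        exact he (by rwa [← h])
      exact hsep x hx y hy (cc_of_dc (p := (_, _)) (q := (_, _)) (P.to_dc hP' 1))
    have hnd : P.verts.Nodup := by
      by_contra hnd
      obtain ⟨z, A, B, C, rfl, hB⟩ := P.dup_vert hnd
      have := hmin _ _ (A.append C) hx hy
      simp only [Walk.edges_append, List.length_append] at this
      have hB' := List.length_pos_iff.2 hB
      omega
    have hP1 : ∀ z ∈ P.verts, z ∈ C₁.srcs → z = x := by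
      intro z hz hz1
      obtain ⟨A, B, rfl⟩ := P.split_vert hz
      have := hmin _ _ B hz1 hy
      simp only [Walk.edges_append, List.length_append] at this
      cases A with
      | nil => rfl
      | cons e d p => simp [Walk.edges] at this
    have hP2 : ∀ z ∈ P.verts, z ∈ C₂.srcs → z = y := by
      intro z hz hz1
      obtain ⟨A, B, rfl⟩ := P.split_vert hz
      have := hmin _ _ A hx hz1
      simp only [Walk.edges_append, List.length_append] at this
      cases B with
      | nil => rfl
      | cons e d p => simp [Walk.edges] at this
    have hnl : ∀ e' ∈ P.edges, Γ.endpt e' true ≠ Γ.endpt e' false := by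
      intro e' he' heq
      obtain ⟨d, A, B, rfl⟩ := P.split_edge he'
      rw [Walk.verts_eq, Walk.srcs_append, Walk.srcs_cons, List.append_assoc,
        List.cons_append, ← Walk.verts_eq, List.nodup_append, List.nodup_cons] at hnd
      have h0 : Γ.endpt e' (!d) = Γ.endpt e' d := by cases d <;> simp [heq]
      apply hnd.2.1.1
      rw [← h0]
      exact B.start_mem
    obtain ⟨D₁, g1, g2, g3⟩ := rotate_cycle C₁ h1 hx
    obtain ⟨D₂, g1', g2', g3'⟩ := rotate_cycle C₂ h1' hy
    refine ⟨x, y, D₁, P, D₂, ⟨g1, g1', ⟨List.ne_nil_of_mem heP, hnd⟩, ?_, ?_, ?_, ?_⟩, heP⟩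
    · intro z hz hz'
      exact hsep z ((g2 z).1 hz) z ((g2' z).1 hz') rfl
    · intro z hz hz'; exact hP1 z hz ((g2 z).1 hz')
    · intro z hz hz'; exact hP2 z hz ((g2' z).1 hz')
    · intro e' he'
      refine ⟨fun h => ?_, fun h => ?_⟩
      · apply hnl e' he'
        rw [hP1 _ (P.edge_verts he' true) (C₁.edge_srcs ((g3 _).1 h) true),
          hP1 _ (P.edge_verts he' false) (C₁.edge_srcs ((g3 _).1 h) false)]
      · apply hnl e' he'
        rw [hP2 _ (P.edge_verts he' true) (C₂.edge_srcs ((g3' _).1 h) true),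
          hP2 _ (P.edge_verts he' false) (C₂.edge_srcs ((g3' _).1 h) false)]

end SGraph
end Recipe2

noncomputable section Recipe3
open SGraph
namespace SGraph

theorem pow3_congr {K : Type*} [CommMonoid K] {a b c : K} {i j k i' j' k' : ℕ}
    (hi : i = i') (hj : j = j') (hk : k = k') :
    a ^ i * b ^ j * c ^ k = a ^ i' * b ^ j' * c ^ k' := by
  subst hi hj hk; rfl

theorem pow3_mul {K : Type*} [CommRing K] {a b c : K} {i j k i1 j1 k1 i2 j2 k2 : ℕ}
    (hi : i = i1 + i2) (hj : j = j1 + j2) (hk : k = k1 + k2) :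
    a ^ i * b ^ j * c ^ k = (a ^ i1 * b ^ j1 * c ^ k1) * (a ^ i2 * b ^ j2 * c ^ k2) := by
  subst hi hj hk; ring

theorem pow3_mul_mul {K : Type*} [CommRing K] {a b c t1 t2 : K} {i j k i1 j1 k1 i2 j2 k2 : ℕ}
    (hi : i = i1 + i2) (hj : j = j1 + j2) (hk : k = k1 + k2) :
    a ^ i * b ^ j * c ^ k * (t1 * t2) =
      (a ^ i1 * b ^ j1 * c ^ k1 * t1) * (a ^ i2 * b ^ j2 * c ^ k2 * t2) := by
  subst hi hj hk; ring

theorem sum_split {E K : Type*} [Fintype E] [AddCommMonoid K] (e : E)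
    [Fintype {e' : E // e' ≠ e}] (f : Finset E → K) :
    ∑ A : Finset E, f A =
      ∑ B : Finset {e' : E // e' ≠ e}, f (B.map (Function.Embedding.subtype _)) +
      ∑ B : Finset {e' : E // e' ≠ e}, f (insert e (B.map (Function.Embedding.subtype _))) := by
  have key : ∀ g : Finset E → K, ∑ t ∈ (Finset.univ.erase e).powerset, g t =
      ∑ B : Finset {e' : E // e' ≠ e}, g (B.map (Function.Embedding.subtype _)) := by
    intro g
    refine Finset.sum_nbij' (fun t => t.subtype (· ≠ e))
      (fun B => B.map (Function.Embedding.subtype _)) ?_ ?_ ?_ ?_ ?_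
    · intro t _; simp
    · intro B _
      simp only [Finset.mem_powerset]
      intro x hx
      simp only [Finset.mem_map, Function.Embedding.subtype_apply] at hx
      obtain ⟨y, -, rfl⟩ := hx
      simp [y.2]
    · intro t ht
      rw [Finset.subtype_map_of_mem]
      intro x hx
      exact (Finset.mem_erase.1 (Finset.mem_powerset.1 ht hx)).1
    · intro B _
      ext x; simp [x.2]
    · intro t ht
      rw [Finset.subtype_map_of_mem]
      intro x hx
      exact (Finset.mem_erase.1 (Finset.mem_powerset.1 ht hx)).1
  rw [← key, ← key (fun t => f (insert e t)), ← Finset.sum_powerset_insert (by simp),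
    Finset.insert_erase (Finset.mem_univ e), Finset.powerset_univ]

variable {V E K : Type*} [CommRing K]

/-- One term of the Tutte sum. -/
def tm (Γ : SGraph V E) (k : ℕ) (X Y Z : K) (c : ℕ) (S : Set E) : K :=
  (X - 1) ^ (Γ.kS S - k) * (Y - 1) ^ ((c + (Γ.dS S - Γ.kS S)) - Nat.card V) *
    (Z - 1) ^ (2 * Γ.kS S - Γ.dS S)

theorem tutte_eq (Γ : SGraph V E) [Finite V] [Fintype E] (X Y Z : K) :
    Γ.signedTutte X Y Z = ∑ A : Finset E, Γ.tm (Γ.kS Set.univ) X Y Z A.card (A : Set E) := by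
  unfold signedTutte
  rw [finsum_eq_sum_of_fintype]
  refine Finset.sum_congr rfl fun A _ => ?_
  rw [kAll_eq_kS, kAll_eq_kS, kb_eq, ku_eq, kS_restrict, dS_restrict]
  rfl

section rec
variable (Γ : SGraph V E) [Finite V] [Fintype E] (e : E) [Fintype {e' : E // e' ≠ e}] (X Y Z : K)

def t0 : K := ∑ B : Finset {e' : E // e' ≠ e},
  Γ.tm (Γ.kS Set.univ) X Y Z B.card (Subtype.val '' (B : Set {e' : E // e' ≠ e}))
def t1 : K := ∑ B : Finset {e' : E // e' ≠ e},
  Γ.tm (Γ.kS Set.univ) X Y Z (B.card + 1) (insert e (Subtype.val '' (B : Set {e' : E // e' ≠ e})))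

theorem tutte_split : Γ.signedTutte X Y Z = Γ.t0 e X Y Z + Γ.t1 e X Y Z := by
  rw [tutte_eq, sum_split e]
  unfold t0 t1
  congr 1
  · refine Finset.sum_congr rfl fun B _ => ?_
    rw [Finset.card_map, Finset.coe_map]; rfl
  · refine Finset.sum_congr rfl fun B _ => ?_
    rw [Finset.card_insert_of_notMem (by simp), Finset.card_map, Finset.coe_insert,
      Finset.coe_map]; rfl

theorem img_univ {E : Type*} (e : E) : (Subtype.val '' (Set.univ : Set {e' : E // e' ≠ e})) = {e}ᶜ := by
  ext x; simp

theorem ins_compl {E : Type*} (e : E) : insert e ({e}ᶜ : Set E) = Set.univ := by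
  ext x; by_cases h : x = e <;> simp [h]

theorem img_sub {E : Type*} (e : E) (B : Set {e' : E // e' ≠ e}) : Subtype.val '' B ⊆ ({e}ᶜ : Set E) := by
  rintro x ⟨y, -, rfl⟩; exact y.2

theorem t1_contract (hs : Γ.sign e = 1) (hl : ¬ Γ.IsLoop e) :
    Γ.t1 e X Y Z = (Γ.contract e).signedTutte X Y Z := by
  rw [tutte_eq]
  unfold t1
  refine Finset.sum_congr rfl fun B _ => ?_
  unfold tm
  rw [kS_contract, kS_contract, dS_contract _ _ hs, img_univ, ins_compl, Γ.card_contract e hl]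
  congr 3
  omega

theorem t0_delete_cc (h : Γ.cc {e}ᶜ (Γ.ends e).1 (Γ.ends e).2) :
    Γ.t0 e X Y Z = (Γ.deleteEdge e).signedTutte X Y Z := by
  rw [tutte_eq]
  unfold t0
  refine Finset.sum_congr rfl fun B _ => ?_
  unfold tm
  rw [kS_delete, kS_delete, dS_delete, img_univ, Γ.kS_insert_cc _ e h, ins_compl]

theorem t0_delete_ncc (h : ¬ Γ.cc {e}ᶜ (Γ.ends e).1 (Γ.ends e).2) :
    Γ.t0 e X Y Z = (X - 1) * (Γ.deleteEdge e).signedTutte X Y Z := by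
  rw [tutte_eq, Finset.mul_sum]
  unfold t0
  refine Finset.sum_congr rfl fun B _ => ?_
  unfold tm
  have h1 := Γ.kS_insert_ncc _ e h
  have h2 := Γ.kS_anti (img_sub e B)
  rw [ins_compl] at h1
  rw [kS_delete, kS_delete, dS_delete, img_univ]
  have h3 : Γ.kS (Subtype.val '' (B : Set {e' : E // e' ≠ e})) - Γ.kS Set.univ =
    (Γ.kS (Subtype.val '' (B : Set {e' : E // e' ≠ e})) - Γ.kS {e}ᶜ) + 1 := by omega
  rw [h3, pow_succ]
  ring

theorem t0_t1_ncc (h : ¬ Γ.cc {e}ᶜ (Γ.ends e).1 (Γ.ends e).2)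
    (h' : ¬ (Γ.ub {e}ᶜ (Γ.ends e).1 ∧ Γ.ub {e}ᶜ (Γ.ends e).2)) :
    Γ.t0 e X Y Z = (X - 1) * Γ.t1 e X Y Z := by
  unfold t0 t1
  rw [Finset.mul_sum]
  refine Finset.sum_congr rfl fun B _ => ?_
  unfold tm
  have h1 := Γ.kS_insert_ncc (Subtype.val '' (B : Set {e' : E // e' ≠ e})) e
    (fun hc => h (cc_mono (img_sub e _) hc))
  have h2 := Γ.dS_insert_ncc_nub (Subtype.val '' (B : Set {e' : E // e' ≠ e})) e
    (fun hc => h (cc_mono (img_sub e _) hc))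
    (fun hc => h' ⟨dc_mono (img_sub e _) hc.1, dc_mono (img_sub e _) hc.2⟩)
  have h3 := Γ.kS_anti (Set.subset_univ (insert e (Subtype.val '' (B : Set {e' : E // e' ≠ e}))))
  have h4 := Γ.kS_le_dS (insert e (Subtype.val '' (B : Set {e' : E // e' ≠ e})))
  rw [h1, h2, ← mul_assoc, ← mul_assoc, ← pow_succ']
  exact pow3_congr (by omega) (by omega) (by omega)

theorem t1_loop (hs : Γ.sign e = 1) (hl : Γ.IsLoop e) :
    Γ.t1 e X Y Z = (Y - 1) * Γ.t0 e X Y Z := by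
  unfold t0 t1
  rw [Finset.mul_sum]
  refine Finset.sum_congr rfl fun B _ => ?_
  unfold tm
  have hl' : (Γ.ends e).1 = (Γ.ends e).2 := hl
  have h1 := Γ.kS_insert_cc (Subtype.val '' (B : Set {e' : E // e' ≠ e})) e
    (by rw [hl']; rfl)
  have h2 := Γ.dS_insert_dc (Subtype.val '' (B : Set {e' : E // e' ≠ e})) e
    (by rw [hs, hl']; rfl)
  have h3 := Γ.rank_le (B.map (Function.Embedding.subtype _))
  rw [Finset.card_map, Finset.coe_map] at h3
  change _ + Γ.kS (Subtype.val '' _) ≤ _ + Γ.dS (Subtype.val '' _) at h3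
  have h4 := Γ.kS_le_dS (Subtype.val '' (B : Set {e' : E // e' ≠ e}))
  rw [← h1, ← h2]
  generalize Γ.kS (Subtype.val '' (B : Set {e' : E // e' ≠ e})) = k at *
  generalize Γ.dS (Subtype.val '' (B : Set {e' : E // e' ≠ e})) = d at *
  have h5 : B.card + 1 + (d - k) - Nat.card V = (B.card + (d - k) - Nat.card V) + 1 := by omega
  rw [h5, pow_succ]
  ring

end rec

theorem tutte_switch (Γ : SGraph V E) [Finite V] [Finite E] (U : Set V) (X Y Z : K) :
    (Γ.switchSet U).signedTutte X Y Z = Γ.signedTutte X Y Z := by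
  have := Fintype.ofFinite E
  rw [tutte_eq, tutte_eq]
  unfold tm
  simp only [kS_switch, dS_switch]

theorem tutte_iso {V₁ E₁ V₂ E₂ : Type*} [Finite V₁] [Finite E₁] [Finite V₂] [Finite E₂]
    {Γ₁ : SGraph V₁ E₁} {Γ₂ : SGraph V₂ E₂}
    (φ : V₁ ≃ V₂) (ψ : E₁ ≃ E₂) (h : ∀ e : E₁,
    (Γ₂.ends (ψ e) = (φ (Γ₁.ends e).1, φ (Γ₁.ends e).2) ∨
      Γ₂.ends (ψ e) = (φ (Γ₁.ends e).2, φ (Γ₁.ends e).1)) ∧ Γ₂.sign (ψ e) = Γ₁.sign e)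
    (X Y Z : K) : Γ₁.signedTutte X Y Z = Γ₂.signedTutte X Y Z := by
  have := Fintype.ofFinite E₁
  have := Fintype.ofFinite E₂
  rw [tutte_eq, tutte_eq]
  refine Fintype.sum_equiv ψ.finsetCongr _ _ fun A => ?_
  unfold tm
  simp only [kS_iso φ ψ (fun e => (h e).1), dS_iso φ ψ h, Nat.card_congr φ,
    Equiv.finsetCongr_apply, Finset.card_map, Finset.coe_map, Set.image_univ, Equiv.range_eq_univ,
    Equiv.coe_toEmbedding]

theorem tutte_disj {V₁ E₁ V₂ E₂ : Type*} [Finite V₁] [Finite E₁] [Finite V₂] [Finite E₂]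
    (Γ₁ : SGraph V₁ E₁) (Γ₂ : SGraph V₂ E₂) (X Y Z : K) :
    (Γ₁.disjUnion Γ₂).signedTutte X Y Z = Γ₁.signedTutte X Y Z * Γ₂.signedTutte X Y Z := by
  have := Fintype.ofFinite E₁
  have := Fintype.ofFinite E₂
  rw [tutte_eq, tutte_eq, tutte_eq, Finset.sum_mul_sum, ← Fintype.sum_prod_type']
  refine Fintype.sum_equiv Finset.sumEquiv.toEquiv _ _ fun A => ?_
  obtain ⟨⟨A₁, A₂⟩, rfl⟩ := Finset.sumEquiv.symm.surjective A
  simp only [Finset.sumEquiv_symm_apply, RelIso.coe_fn_toEquiv]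
  have hA : Finset.sumEquiv (A₁.disjSum A₂) = (A₁, A₂) := Finset.sumEquiv.apply_symm_apply (A₁, A₂)
  rw [hA]
  have hu : (Set.univ : Set (E₁ ⊕ E₂)) = Sum.inl '' Set.univ ∪ Sum.inr '' Set.univ := by
    ext x; cases x <;> simp
  have hc : ((A₁.disjSum A₂ : Finset (E₁ ⊕ E₂)) : Set (E₁ ⊕ E₂)) =
      Sum.inl '' (A₁ : Set E₁) ∪ Sum.inr '' (A₂ : Set E₂) := by
    ext x; cases x <;> simp
  unfold tm
  rw [hu, hc, kS_disj, kS_disj, dS_disj, Nat.card_sum, Finset.card_disjSum]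
  have a1 := Γ₁.kS_le_dS (A₁ : Set E₁)
  have a2 := Γ₂.kS_le_dS (A₂ : Set E₂)
  have b1 := Γ₁.rank_le A₁
  have b2 := Γ₂.rank_le A₂
  have c1 := Γ₁.kS_anti (Set.subset_univ (A₁ : Set E₁))
  have c2 := Γ₂.kS_anti (Set.subset_univ (A₂ : Set E₂))
  dsimp only
  exact pow3_mul (by omega) (by omega) (by omega)

/-- the right-hand side -/
def rhs {K : Type*} [Field K] (α β γ x y z : K) (Γ : SGraph V E) : K :=
  α ^ (Nat.card V - Γ.kAll) * β ^ ((Nat.card E + Γ.kb) - Nat.card V) *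
        γ ^ Γ.ku * Γ.signedTutte (x / α) (y / β) (z / γ)

section rhs
variable {K : Type*} [Field K] (α β γ x y z : K)

theorem rhs_switch (Γ : SGraph V E) [Finite V] [Finite E] (U : Set V) :
    (Γ.switchSet U).rhs α β γ x y z = Γ.rhs α β γ x y z := by
  unfold rhs
  simp only [tutte_switch, kAll_eq_kS, kb_eq, ku_eq, kS_switch, dS_switch]

theorem rhs_iso {V₁ E₁ V₂ E₂ : Type*} [Finite V₁] [Finite E₁] [Finite V₂] [Finite E₂]
    {Γ₁ : SGraph V₁ E₁} {Γ₂ : SGraph V₂ E₂} (h : Γ₁.Iso Γ₂) :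
    Γ₁.rhs α β γ x y z = Γ₂.rhs α β γ x y z := by
  obtain ⟨φ, ψ, h⟩ := h
  unfold rhs
  simp only [tutte_iso φ ψ h, kAll_eq_kS, kb_eq, ku_eq, kS_iso φ ψ (fun e => (h e).1),
    dS_iso φ ψ h, Nat.card_congr φ, Nat.card_congr ψ, Set.image_univ, Equiv.range_eq_univ]

theorem rank_univ (Γ : SGraph V E) [Finite V] [Finite E] :
    Nat.card V + Γ.kS Set.univ ≤ Nat.card E + Γ.dS Set.univ := by
  have := Fintype.ofFinite E
  have h := Γ.rank_le Finset.univ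
  rw [Finset.coe_univ, Finset.card_univ, ← Nat.card_eq_fintype_card] at h
  exact h

theorem rhs_disj {V₁ E₁ V₂ E₂ : Type*} [Finite V₁] [Finite E₁] [Finite V₂] [Finite E₂]
    (Γ₁ : SGraph V₁ E₁) (Γ₂ : SGraph V₂ E₂) :
    (Γ₁.disjUnion Γ₂).rhs α β γ x y z = Γ₁.rhs α β γ x y z * Γ₂.rhs α β γ x y z := by
  unfold rhs
  have hu : (Set.univ : Set (E₁ ⊕ E₂)) = Sum.inl '' Set.univ ∪ Sum.inr '' Set.univ := by
    ext x; cases x <;> simp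
  simp only [tutte_disj, kAll_eq_kS, kb_eq, ku_eq]
  rw [hu, kS_disj, dS_disj, Nat.card_sum, Nat.card_sum]
  have a1 := Γ₁.kS_le_dS Set.univ
  have a2 := Γ₂.kS_le_dS Set.univ
  have b1 := Γ₁.rank_univ
  have b2 := Γ₂.rank_univ
  have c1 := Γ₁.kS_le_card Set.univ
  have c2 := Γ₂.kS_le_card Set.univ
  exact pow3_mul_mul (by omega) (by omega) (by omega)

theorem rhs_empty (Γ : SGraph V E) [Finite V] [IsEmpty E] : Γ.rhs α β γ x y z = 1 := by
  have := Fintype.ofFinite E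
  have hu : (Set.univ : Set E) = ∅ := Set.univ_eq_empty_iff.2 inferInstance
  unfold rhs
  rw [tutte_eq, kAll_eq_kS, kb_eq, ku_eq, hu, kS_empty, dS_empty]
  have h1 : ∀ A : Finset E, A = ∅ := fun A => Finset.eq_empty_of_isEmpty A
  rw [Fintype.sum_eq_single ∅ (fun A hA => absurd (h1 A) hA)]
  unfold tm
  rw [Finset.coe_empty, kS_empty, dS_empty, Finset.card_empty,
    Nat.card_of_isEmpty (α := E)]
  generalize Nat.card V = n
  rw [show 0 + (2 * n - n) - n = 0 by omega, show 2 * n - 2 * n = 0 by omega,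
    show n - n = 0 by omega]
  simp

theorem sum_bouquet (Y : K) {ι : Type*} (s : Finset ι) :
    ∑ A ∈ s.powerset, (if A = ∅ then (0 : K) else (Y - 1) ^ (A.card - 1)) =
      ∑ j ∈ Finset.range s.card, Y ^ j := by
  induction s using Finset.induction_on with
  | empty => simp
  | insert a s ha ih =>
    rw [Finset.sum_powerset_insert ha, ih, Finset.card_insert_of_notMem ha,
      Finset.sum_range_succ]
    congr 1
    have h := Finset.sum_pow_mul_eq_add_pow (Y - 1) 1 s
    simp only [one_pow, mul_one, sub_add_cancel] at h
    rw [← h]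
    refine Finset.sum_congr rfl fun A hA => ?_
    have : a ∉ A := fun h => ha (Finset.mem_powerset.1 hA h)
    rw [if_neg (Finset.insert_ne_empty _ _), Finset.card_insert_of_notMem this]
    simp

theorem rhs_bouquet (hβ : β ≠ 0) (hγ : γ ≠ 0) (Γ : SGraph V E) [Finite V] [Finite E] (l : ℕ)
    (hl : 1 ≤ l) (hV : Nat.card V = 1) (hE : Nat.card E = l)
    (h : ∀ e : E, Γ.IsLoop e ∧ Γ.sign e = -1) :
    Γ.rhs α β γ x y z = β ^ (l - 1) * γ +
            (z - γ) * ∑ i ∈ Finset.range l, y ^ (l - 1 - i) * β ^ i := by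
  have := Fintype.ofFinite E
  obtain ⟨v⟩ : Nonempty V := (Nat.card_pos_iff.1 (by omega : 0 < Nat.card V)).1
  have hk : ∀ S, Γ.kS S = 1 := by
    intro S
    have h1 := Γ.kS_le_card S
    have : Nonempty (Quot (Γ.adjS S)) := ⟨Quot.mk _ v⟩
    have h2 : 0 < Γ.kS S := Nat.card_pos
    omega
  have hd : ∀ S : Set E, S.Nonempty → Γ.dS S = 1 := by
    rintro S ⟨e, he⟩
    have h1 := Γ.dS_insert_cc_ndc ∅ e (by rw [show (Γ.ends e).1 = (Γ.ends e).2 from (h e).1]; rfl)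
      (by
        rw [show (Γ.ends e).1 = (Γ.ends e).2 from (h e).1, (h e).2]
        intro h2
        have h3 := congrArg (Quot.lift id
          (by rintro a b ⟨e, he, _⟩; exact absurd he (by simp))) h2
        simp at h3)
    rw [dS_empty, hV] at h1
    have h2 := Γ.dS_anti (S := insert e ∅) (T := S) (by simpa using he)
    have h3 := Γ.kS_le_dS S
    rw [hk] at h3
    omega
  have hne : (Set.univ : Set E).Nonempty := by
    have : Nonempty E := (Nat.card_pos_iff.1 (by omega : 0 < Nat.card E)).1
    exact Set.univ_nonempty
  unfold rhs
  rw [tutte_eq, kAll_eq_kS, kb_eq, ku_eq, hk, hd _ hne, hV, hE]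
  have ht : ∀ A : Finset E, Γ.tm 1 (x / α) (y / β) (z / γ) A.card (A : Set E) =
      (if A = ∅ then 1 else 0) +
        (z / γ - 1) * (if A = ∅ then (0 : K) else (y / β - 1) ^ (A.card - 1)) := by
    intro A
    unfold tm
    rw [hk, hV]
    by_cases hA : A = ∅
    · subst hA
      simp [dS_empty, hV]
    · rw [hd A (by simpa using Finset.nonempty_iff_ne_empty.2 hA)]
      simp [hA, mul_comm]
  rw [Finset.sum_congr rfl (fun A _ => ht A), Finset.sum_add_distrib, ← Finset.mul_sum]
  have := sum_bouquet (y / β) (Finset.univ : Finset E)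
  rw [Finset.powerset_univ, Finset.card_univ, ← Nat.card_eq_fintype_card, hE] at this
  rw [this, Finset.sum_ite_eq' Finset.univ, if_pos (Finset.mem_univ _),
    ← Finset.sum_range_reflect]
  have h6 : (z - γ) * ∑ i ∈ Finset.range l, y ^ (l - 1 - i) * β ^ i =
      β ^ (l - 1) * γ * ((z / γ - 1) * ∑ j ∈ Finset.range l, (y / β) ^ (l - 1 - j)) := by
    have : (z - γ) = γ * (z / γ - 1) := by field_simp
    rw [this, mul_comm (β ^ (l - 1)) γ, Finset.mul_sum, Finset.mul_sum, Finset.mul_sum]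
    refine Finset.sum_congr rfl fun i hi => ?_
    have hi' := Finset.mem_range.1 hi
    have : β ^ (l - 1) = β ^ (l - 1 - i) * β ^ i := by rw [← pow_add]; congr 1; omega
    rw [this, div_pow]
    have := pow_ne_zero (l - 1 - i) hβ
    field_simp
  rw [h6]
  have e1 : l + (1 - 1) - 1 = l - 1 := by omega
  rw [e1]
  simp only [Nat.sub_self, pow_zero, one_mul, mul_one]
  rw [show 2 - 1 = 1 from rfl, pow_one]
  ring

end rhs

end SGraph
end Recipe3

noncomputable section Recipe4
open SGraph
namespace SGraph

section steps
variable {V E K : Type*} [Field K] (α β γ x y z : K)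
variable (Γ : SGraph V E) [Finite V] [Finite E] (e : E)

theorem card_del {E : Type*} [Finite E] (e : E) :
    Nat.card E = Nat.card {e' : E // e' ≠ e} + 1 := by
  have := Fintype.ofFinite E
  have h := Fintype.card_subtype_compl (fun x : E => x = e)
  rw [Fintype.card_subtype_eq] at h
  have h2 : 0 < Fintype.card E := Fintype.card_pos_iff.2 ⟨e⟩
  rw [Nat.card_eq_fintype_card, Nat.card_eq_fintype_card]
  change Fintype.card {e' : E // ¬ e' = e} = _ at h
  change _ = Fintype.card {e' : E // ¬ e' = e} + 1
  omega

theorem rhs_eq : Γ.rhs α β γ x y z =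
    α ^ (Nat.card V - Γ.kS Set.univ) *
      β ^ (Nat.card E + (Γ.dS Set.univ - Γ.kS Set.univ) - Nat.card V) *
      γ ^ (2 * Γ.kS Set.univ - Γ.dS Set.univ) * Γ.signedTutte (x / α) (y / β) (z / γ) := by
  unfold rhs
  rw [kAll_eq_kS, kb_eq, ku_eq]

theorem kS_del : (Γ.deleteEdge e).kS Set.univ = Γ.kS {e}ᶜ := by
  rw [kS_delete, img_univ]
theorem dS_del : (Γ.deleteEdge e).dS Set.univ = Γ.dS {e}ᶜ := by
  rw [dS_delete, img_univ]
theorem kS_con : (Γ.contract e).kS Set.univ = Γ.kS Set.univ := by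
  rw [kS_contract, img_univ, ins_compl]
theorem dS_con (hs : Γ.sign e = 1) : (Γ.contract e).dS Set.univ = Γ.dS Set.univ := by
  rw [dS_contract _ _ hs, img_univ, ins_compl]

theorem bridge_iff : Γ.IsBridge e ↔ ¬ Γ.cc {e}ᶜ (Γ.ends e).1 (Γ.ends e).2 := by
  unfold IsBridge
  rw [kAll_eq_kS, kAll_eq_kS, kS_del]
  by_cases h : Γ.cc {e}ᶜ (Γ.ends e).1 (Γ.ends e).2
  · have h1 := Γ.kS_insert_cc _ e h
    rw [ins_compl] at h1
    simp [h, h1]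
  · have h1 := Γ.kS_insert_ncc _ e h
    rw [ins_compl] at h1
    simp [h, h1]

theorem con_part (hs : Γ.sign e = 1) (hl : ¬ Γ.IsLoop e) (T : K)
    (hT : T = (Γ.contract e).signedTutte (x / α) (y / β) (z / γ)) :
    α ^ (Nat.card V - Γ.kS Set.univ) *
      β ^ (Nat.card E + (Γ.dS Set.univ - Γ.kS Set.univ) - Nat.card V) *
      γ ^ (2 * Γ.kS Set.univ - Γ.dS Set.univ) * T =
    α * (Γ.contract e).rhs α β γ x y z := by
  have : Finite (Quot (Γ.contractRel e)) := inferInstance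
  have h1 := (Γ.contract e).kS_le_card Set.univ
  rw [rhs_eq, hT, ← mul_assoc, ← mul_assoc, ← mul_assoc, ← pow_succ']
  rw [kS_con] at h1 ⊢
  rw [dS_con _ _ hs]
  have h2 := Γ.card_contract e hl
  have h3 := card_del e
  congr 1
  exact pow3_congr (by omega) (by omega) rfl

theorem step_dc (hs : Γ.sign e = 1) (hl : ¬ Γ.IsLoop e) (hβ : β ≠ 0)
    (hc : Γ.cc {e}ᶜ (Γ.ends e).1 (Γ.ends e).2)
    (hd : Γ.dS {e}ᶜ = Γ.dS Set.univ) :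
    Γ.rhs α β γ x y z = α * (Γ.contract e).rhs α β γ x y z +
      β * (Γ.deleteEdge e).rhs α β γ x y z := by
  have := Fintype.ofFinite E
  have := Fintype.ofFinite {e' : E // e' ≠ e}
  have h1 := Γ.kS_insert_cc _ e hc
  rw [ins_compl] at h1
  rw [← Γ.con_part α β γ x y z e hs hl _ rfl, rhs_eq, tutte_split Γ e, t0_delete_cc _ _ _ _ _ hc,
    t1_contract _ _ _ _ _ hs hl, mul_add, add_comm]
  congr 1
  have h2 := (Γ.deleteEdge e).rank_univ
  rw [rhs_eq]
  rw [kS_del, dS_del] at h2 ⊢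
  have h3 := card_del e
  have h4 := Γ.kS_le_dS {e}ᶜ
  rw [← h1, ← hd, h3]
  rw [show Nat.card {e' : E // e' ≠ e} + 1 + (Γ.dS {e}ᶜ - Γ.kS {e}ᶜ) - Nat.card V =
    Nat.card {e' : E // e' ≠ e} + (Γ.dS {e}ᶜ - Γ.kS {e}ᶜ) - Nat.card V + 1 by omega, pow_succ]
  ring

theorem step_ndc (hs : Γ.sign e = 1) (hl : ¬ Γ.IsLoop e)
    (hc : Γ.cc {e}ᶜ (Γ.ends e).1 (Γ.ends e).2)
    (hd : Γ.dS {e}ᶜ = Γ.dS Set.univ + 1) :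
    Γ.rhs α β γ x y z = α * (Γ.contract e).rhs α β γ x y z +
      γ * (Γ.deleteEdge e).rhs α β γ x y z := by
  have := Fintype.ofFinite E
  have := Fintype.ofFinite {e' : E // e' ≠ e}
  have h1 := Γ.kS_insert_cc _ e hc
  rw [ins_compl] at h1
  rw [← Γ.con_part α β γ x y z e hs hl _ rfl, rhs_eq, tutte_split Γ e, t0_delete_cc _ _ _ _ _ hc,
    t1_contract _ _ _ _ _ hs hl, mul_add, add_comm]
  congr 1
  rw [rhs_eq, kS_del, dS_del]
  have h3 := card_del e
  have h4 := Γ.kS_le_dS {e}ᶜ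
  have h5 := Γ.kS_le_dS Set.univ
  rw [h1, hd, h3] at *
  rw [show Nat.card {e' : E // e' ≠ e} + 1 + (Γ.dS Set.univ - Γ.kS Set.univ) - Nat.card V =
    Nat.card {e' : E // e' ≠ e} + (Γ.dS Set.univ + 1 - Γ.kS Set.univ) - Nat.card V by omega,
    show 2 * Γ.kS Set.univ - Γ.dS Set.univ = 2 * Γ.kS Set.univ - (Γ.dS Set.univ + 1) + 1 by omega,
    pow_succ]
  ring

theorem step_ub (hs : Γ.sign e = 1) (hl : ¬ Γ.IsLoop e) (hα : α ≠ 0) (hγ : γ ≠ 0)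
    (hc : ¬ Γ.cc {e}ᶜ (Γ.ends e).1 (Γ.ends e).2)
    (hd : Γ.dS {e}ᶜ = Γ.dS Set.univ + 1) :
    Γ.rhs α β γ x y z = α * (Γ.contract e).rhs α β γ x y z +
      (β * (x - α) / γ) * (Γ.deleteEdge e).rhs α β γ x y z := by
  have := Fintype.ofFinite E
  have := Fintype.ofFinite {e' : E // e' ≠ e}
  have h1 := Γ.kS_insert_ncc _ e hc
  rw [ins_compl] at h1
  rw [← Γ.con_part α β γ x y z e hs hl _ rfl, rhs_eq, tutte_split Γ e, t0_delete_ncc _ _ _ _ _ hc,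
    t1_contract _ _ _ _ _ hs hl, mul_add, add_comm]
  congr 1
  have h2 := (Γ.deleteEdge e).rank_univ
  have h6 := Γ.kS_le_card {e}ᶜ
  rw [rhs_eq]
  rw [kS_del, dS_del] at h2 ⊢
  have h3 := card_del e
  have h4 := Γ.kS_le_dS {e}ᶜ
  have h5 := Γ.kS_le_dS Set.univ
  rw [h1, hd] at *
  rw [h3]
  generalize Γ.kS Set.univ = k at *
  generalize Γ.dS Set.univ = d at *
  generalize Nat.card V = n at *
  generalize Nat.card {e' : E // e' ≠ e} = m at *
  generalize (Γ.deleteEdge e).signedTutte (x / α) (y / β) (z / γ) = T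
  rw [show n - k = n - (k + 1) + 1 by omega, show m + 1 + (d - k) - n =
    m + (d + 1 - (k + 1)) - n + 1 by omega, show 2 * (k + 1) - (d + 1) = 2 * k - d + 1 by omega]
  rw [pow_succ, pow_succ, pow_succ]
  have : x / α - 1 = (x - α) / α := by field_simp
  rw [this]
  field_simp

theorem step_nub (hs : Γ.sign e = 1) (hl : ¬ Γ.IsLoop e) (hα : α ≠ 0)
    (hc : ¬ Γ.cc {e}ᶜ (Γ.ends e).1 (Γ.ends e).2)
    (h' : ¬ (Γ.ub {e}ᶜ (Γ.ends e).1 ∧ Γ.ub {e}ᶜ (Γ.ends e).2)) :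
    Γ.rhs α β γ x y z = x * (Γ.contract e).rhs α β γ x y z := by
  have := Fintype.ofFinite E
  have := Fintype.ofFinite {e' : E // e' ≠ e}
  have h0 := Γ.con_part α β γ x y z e hs hl _ rfl
  have h1 : x * (Γ.contract e).rhs α β γ x y z =
    (x / α) * (α * (Γ.contract e).rhs α β γ x y z) := by field_simp
  rw [h1, ← h0, rhs_eq, tutte_split Γ e, t0_t1_ncc _ _ _ _ _ hc h', t1_contract _ _ _ _ _ hs hl]
  ring

theorem step_loop (hs : Γ.sign e = 1) (hl : Γ.IsLoop e) (hβ : β ≠ 0) :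
    Γ.rhs α β γ x y z = y * (Γ.deleteEdge e).rhs α β γ x y z := by
  have := Fintype.ofFinite E
  have := Fintype.ofFinite {e' : E // e' ≠ e}
  have hl' : (Γ.ends e).1 = (Γ.ends e).2 := hl
  have hc : Γ.cc {e}ᶜ (Γ.ends e).1 (Γ.ends e).2 := by rw [hl']; rfl
  have h1 := Γ.kS_insert_cc {e}ᶜ e hc
  have hd := Γ.dS_insert_dc {e}ᶜ e (by rw [hs, hl']; rfl)
  rw [ins_compl] at h1 hd
  have h2 := (Γ.deleteEdge e).rank_univ
  rw [rhs_eq, rhs_eq, tutte_split Γ e, t1_loop _ _ _ _ _ hs hl, t0_delete_cc _ _ _ _ _ hc]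
  rw [kS_del, dS_del] at h2 ⊢
  have h3 := card_del e
  have h4 := Γ.kS_le_dS {e}ᶜ
  rw [← h1, ← hd, h3]
  rw [show Nat.card {e' : E // e' ≠ e} + 1 + (Γ.dS {e}ᶜ - Γ.kS {e}ᶜ) - Nat.card V =
    Nat.card {e' : E // e' ≠ e} + (Γ.dS {e}ᶜ - Γ.kS {e}ᶜ) - Nat.card V + 1 by omega, pow_succ]
  field_simp
  ring

end steps

theorem iso_refl {V E : Type*} (Γ : SGraph V E) : Γ.Iso Γ :=
  ⟨Equiv.refl _, Equiv.refl _, fun _ => ⟨Or.inl rfl, rfl⟩⟩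

theorem switch_empty {V E : Type*} (Γ : SGraph V E) : Γ.switchSet ∅ = Γ := by
  cases Γ; simp [switchSet]

theorem switchEquiv_of_iso {V₁ E₁ V₂ E₂ : Type*} {Γ₁ : SGraph V₁ E₁} {Γ₂ : SGraph V₂ E₂}
    (h : Γ₁.Iso Γ₂) : Γ₁.SwitchEquiv Γ₂ := ⟨∅, by rw [switch_empty]; exact h⟩

/-- The part of a loop-only graph at the vertices satisfying `p`. -/
def loopPart {V E : Type*} (Γ : SGraph V E) (p : V → Prop) :
    SGraph {w : V // p w} {e : E // p (Γ.ends e).1} where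
  ends := fun e => (⟨_, e.2⟩, ⟨_, e.2⟩)
  sign := fun e => Γ.sign e.1

theorem loop_iso {V E : Type*} (Γ : SGraph V E) (h : ∀ e, Γ.IsLoop e) (p : V → Prop) :
    ((Γ.loopPart p).disjUnion (Γ.loopPart fun w => ¬ p w)).Iso Γ := by
  refine ⟨Equiv.sumCompl p, Equiv.sumCompl (fun e => p (Γ.ends e).1), ?_⟩
  rintro (e | e)
  · refine ⟨Or.inl (Prod.ext rfl (h e.1).symm), rfl⟩
  · refine ⟨Or.inl (Prod.ext rfl (h e.1).symm), rfl⟩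

end SGraph
end Recipe4

section Statement

open SGraph

/-- Theorem 4.2 (Recipe Theorem): universality of the signed Tutte polynomial
for deletion–contraction invariants of signed graphs. -/
theorem recipe_theorem {K : Type} [Field K]
    (R : ∀ (V E : Type) [Finite V] [Finite E], SGraph V E → K)
    (α β γ x y z : K) (hα : α ≠ 0) (hβ : β ≠ 0) (hγ : γ ≠ 0)
    -- invariance under switching equivalence
    (hinv : ∀ (V₁ E₁ V₂ E₂ : Type) [Finite V₁] [Finite E₁] [Finite V₂] [Finite E₂]
      (Γ₁ : SGraph V₁ E₁) (Γ₂ : SGraph V₂ E₂),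
        SGraph.SwitchEquiv Γ₁ Γ₂ → R V₁ E₁ Γ₁ = R V₂ E₂ Γ₂)
    -- multiplicativity over disjoint unions
    (hmul : ∀ (V₁ E₁ V₂ E₂ : Type) [Finite V₁] [Finite E₁] [Finite V₂] [Finite E₂]
      (Γ₁ : SGraph V₁ E₁) (Γ₂ : SGraph V₂ E₂),
        R (V₁ ⊕ V₂) (E₁ ⊕ E₂) (Γ₁.disjUnion Γ₂) = R V₁ E₁ Γ₁ * R V₂ E₂ Γ₂)
    -- deletion–contraction recurrence for positive edges
    (hrec : ∀ (V E : Type) [Finite V] [Finite E] (Γ : SGraph V E) (e : E),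
      Γ.sign e = 1 →
        ((¬ Γ.IsLoop e ∧ ¬ Γ.IsBridge e ∧ (Γ.deleteEdge e).ku = Γ.ku →
            R V E Γ = α * R _ _ (Γ.contract e) + β * R _ _ (Γ.deleteEdge e)) ∧
          (¬ Γ.IsLoop e ∧ ¬ Γ.IsBridge e ∧ (Γ.deleteEdge e).ku < Γ.ku →
            R V E Γ = α * R _ _ (Γ.contract e) + γ * R _ _ (Γ.deleteEdge e)) ∧
          (Γ.IsBridge e ∧ Γ.IsCircuitPathEdge e →
            R V E Γ = α * R _ _ (Γ.contract e) + (β * (x - α) / γ) * R _ _ (Γ.deleteEdge e)) ∧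
          (Γ.IsBridge e ∧ ¬ Γ.IsCircuitPathEdge e →
            R V E Γ = x * R _ _ (Γ.contract e)) ∧
          (Γ.IsLoop e → R V E Γ = y * R _ _ (Γ.deleteEdge e))))
    -- bouquets of negative loops
    (hbouquet : ∀ (V E : Type) [Finite V] [Finite E] (Γ : SGraph V E) (ℓ : ℕ),
      1 ≤ ℓ → Nat.card V = 1 → Nat.card E = ℓ →
        (∀ e : E, Γ.IsLoop e ∧ Γ.sign e = -1) →
          R V E Γ = β ^ (ℓ - 1) * γ +
            (z - γ) * ∑ i ∈ Finset.range ℓ, y ^ (ℓ - 1 - i) * β ^ i)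
    -- a single vertex with no edges
    (hpoint : ∀ (V E : Type) [Finite V] [Finite E] (Γ : SGraph V E),
      Nat.card V = 1 → IsEmpty E → R V E Γ = 1) :
    ∀ (V E : Type) [Finite V] [Finite E] (Γ : SGraph V E),
      R V E Γ = α ^ (Nat.card V - Γ.kAll) * β ^ ((Nat.card E + Γ.kb) - Nat.card V) *
        γ ^ Γ.ku * Γ.signedTutte (x / α) (y / β) (z / γ) := by
  -- graphs all of whose edges are negative loops
  have hloops : ∀ (n : ℕ) (V E : Type) [Finite V] [Finite E] (Γ : SGraph V E),
      Nat.card V = n → (∀ e, Γ.IsLoop e ∧ Γ.sign e = -1) →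
        R V E Γ = Γ.rhs α β γ x y z := by
    intro n
    induction n with
    | zero =>
      intro V E _ _ Γ hn h
      have hV : IsEmpty V := (Finite.card_eq_zero_iff).1 hn
      have hE : IsEmpty E := ⟨fun e => hV.false (Γ.ends e).1⟩
      rw [rhs_empty]
      let P : SGraph Unit Empty := ⟨fun e => e.elim, fun e => e.elim⟩
      have hP : R Unit Empty P = 1 := hpoint Unit Empty P (by simp) inferInstance
      have h1 := hmul _ _ _ _ Γ P
      have h2 : R (V ⊕ Unit) (E ⊕ Empty) (Γ.disjUnion P) = 1 :=
        hpoint _ _ _ (by rw [Nat.card_sum, hn]; simp) inferInstance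
      rw [h2, hP, mul_one] at h1
      exact h1.symm
    | succ n ih =>
      intro V E _ _ Γ hn h
      obtain ⟨v⟩ : Nonempty V := (Nat.card_pos_iff.1 (by omega : 0 < Nat.card V)).1
      have hi := Γ.loop_iso (fun e => (h e).1) (fun w => w = v)
      rw [← hinv _ _ _ _ _ _ (switchEquiv_of_iso hi), ← rhs_iso α β γ x y z hi, hmul, rhs_disj]
      have hc1 : Nat.card {w : V // w = v} = 1 := by simp
      have hc2 := card_del v
      have hb : ∀ (p : V → Prop) (e), (Γ.loopPart p).IsLoop e ∧ (Γ.loopPart p).sign e = -1 :=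
        fun p e => ⟨rfl, (h e.1).2⟩
      congr 1
      · rcases isEmpty_or_nonempty {e : E // (Γ.ends e).1 = v} with hE | hE
        · rw [rhs_empty]
          exact hpoint _ _ _ hc1 hE
        · have hp : 1 ≤ Nat.card {e : E // (Γ.ends e).1 = v} := Nat.card_pos
          rw [rhs_bouquet α β γ x y z hβ hγ _ _ hp hc1 rfl (hb (fun w => w = v))]
          exact hbouquet _ _ _ _ hp hc1 rfl (hb (fun w => w = v))
      · exact ih _ _ _ (by
          change Nat.card {w : V // w ≠ v} = n
          omega) (hb (fun w => ¬ w = v))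
  have main : ∀ (n : ℕ) (V E : Type) [Finite V] [Finite E] (Γ : SGraph V E),
      Nat.card E = n → R V E Γ = Γ.rhs α β γ x y z := by
    intro n
    induction n with
    | zero =>
      intro V E _ _ Γ hn
      have hE : IsEmpty E := (Finite.card_eq_zero_iff).1 hn
      exact hloops _ V E Γ rfl (fun e => hE.elim e)
    | succ n ih =>
      have hpos : ∀ (V E : Type) [Finite V] [Finite E] (Γ : SGraph V E) (e : E),
          Nat.card E = n + 1 → Γ.sign e = 1 → ¬ Γ.IsLoop e →
            R V E Γ = Γ.rhs α β γ x y z := by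
        intro V E _ _ Γ e hn hs hl
        have hm := card_del e
        have hD := ih _ _ (Γ.deleteEdge e) (by omega)
        have hC := ih _ _ (Γ.contract e) (by omega)
        obtain ⟨r1, r2, r3, r4, -⟩ := hrec V E Γ e hs
        have hbr := Γ.bridge_iff e
        have hku : (Γ.deleteEdge e).ku = 2 * Γ.kS {e}ᶜ - Γ.dS {e}ᶜ := by
          rw [ku_eq, kS_del, dS_del]
        by_cases hc : Γ.cc {e}ᶜ (Γ.ends e).1 (Γ.ends e).2
        · have hnb : ¬ Γ.IsBridge e := fun h => hbr.1 h hc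
          have hk := Γ.kS_insert_cc _ e hc
          rw [ins_compl] at hk
          have h4 := Γ.kS_le_dS {e}ᶜ
          by_cases hd : Γ.dc {e}ᶜ ((Γ.ends e).1, 1) ((Γ.ends e).2, Γ.sign e)
          · have hd' := Γ.dS_insert_dc _ e hd
            rw [ins_compl] at hd'
            rw [r1 ⟨hl, hnb, by rw [hku, ku_eq, hk, hd']⟩, hD, hC]
            exact (Γ.step_dc α β γ x y z e hs hl hβ hc hd').symm
          · have hd' := Γ.dS_insert_cc_ndc _ e hc hd
            rw [ins_compl] at hd'
            rw [r2 ⟨hl, hnb, by rw [hku, ku_eq]; omega⟩, hD, hC]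
            exact (Γ.step_ndc α β γ x y z e hs hl hc hd').symm
        · have hb : Γ.IsBridge e := hbr.2 hc
          have hcp := Γ.cpe_iff e hc
          by_cases hu : Γ.ub {e}ᶜ (Γ.ends e).1 ∧ Γ.ub {e}ᶜ (Γ.ends e).2
          · have hd' := Γ.dS_insert_ncc_ub _ e hc hu.1 hu.2
            rw [ins_compl] at hd'
            rw [r3 ⟨hb, hcp.2 hu⟩, hD, hC]
            exact (Γ.step_ub α β γ x y z e hs hl hα hγ hc hd').symm
          · rw [r4 ⟨hb, fun h => hu (hcp.1 h)⟩, hC]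
            exact (Γ.step_nub α β γ x y z e hs hl hα hc hu).symm
      intro V E _ _ Γ hn
      by_cases h1 : ∃ e, ¬ Γ.IsLoop e
      · obtain ⟨e, hl⟩ := h1
        rcases Int.units_eq_one_or (Γ.sign e) with hs | hs
        · exact hpos V E Γ e hn hs hl
        · have h2 := hpos V E (Γ.switchSet {(Γ.ends e).1}) e hn (by
            have hl' : ¬ (Γ.ends e).2 = (Γ.ends e).1 := fun h => hl h.symm
            simp [switchSet, hl', hs]) hl
          rw [rhs_switch] at h2
          rw [← h2]
          exact hinv _ _ _ _ _ _ ⟨_, iso_refl _⟩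
      · push Not at h1
        by_cases h2 : ∃ e, Γ.sign e = 1
        · obtain ⟨e, hs⟩ := h2
          have hm := card_del e
          rw [(hrec V E Γ e hs).2.2.2.2 (h1 e), ih _ _ (Γ.deleteEdge e) (by omega)]
          exact (Γ.step_loop α β γ x y z e hs (h1 e) hβ).symm
        · refine hloops _ V E Γ rfl fun e => ⟨h1 e, ?_⟩
          exact (Int.units_eq_one_or (Γ.sign e)).resolve_left fun h => h2 ⟨e, h⟩
  intro V E _ _ Γ
  exact main _ V E Γ rfl

end Statement
end

section
/- Let G be a finite additive abelian group and let Σ=(Γ=(V,E),σ) be a signed graph with an orientation ω compatible with σ. Then the number of G-flows of Σ equals |G|^{|E|−|V|+k_b(Σ)} · (|G|/|2G|)^{k_u(Σ)}. -/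
attribute [local instance] Classical.propDecidable

noncomputable section Aux

namespace SGraph

section Helpers

variable {V E : Type} {Γ : SGraph V E}

def Walk.len {u v : V} (W : Γ.Walk u v) : ℕ := W.edges.length

lemma Walk.len_cons (e : E) (d : Bool) {w : V} (p : Γ.Walk (Γ.endpt e (!d)) w) :
    (Walk.cons e d p).len = p.len + 1 := by
  simp [Walk.len, Walk.edges]

lemma Walk.sgn_cons (e : E) (d : Bool) {w : V} (p : Γ.Walk (Γ.endpt e (!d)) w) :
    (Walk.cons e d p).sgn = Γ.sign e * p.sgn := rfl

lemma Walk.verts_ne_nil_s2 {u v : V} (W : Γ.Walk u v) : W.verts ≠ [] := by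
  cases W <;> simp [Walk.verts]

lemma Walk.srcs_cons_s2 (e : E) (d : Bool) {w : V} (p : Γ.Walk (Γ.endpt e (!d)) w) :
    (Walk.cons e d p).srcs = Γ.endpt e d :: p.srcs := by
  simp only [Walk.srcs, Walk.verts]
  rw [List.dropLast_cons_of_ne_nil p.verts_ne_nil_s2]

lemma comp_endpt (e : E) (d : Bool) : Γ.comp (Γ.endpt e (!d)) = Γ.comp (Γ.endpt e d) := by
  apply Quot.sound
  cases d
  · exact ⟨e, Or.inl rfl⟩
  · exact ⟨e, Or.inr rfl⟩

lemma Walk.comp_eq {u v : V} (W : Γ.Walk u v) : Γ.comp v = Γ.comp u := by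
  induction W with
  | nil v => rfl
  | cons e d p ih => exact ih.trans (comp_endpt e d)

lemma Walk.sgn_append_s2 {u v w : V} (A : Γ.Walk u v) (B : Γ.Walk v w) :
    (A.append B).sgn = A.sgn * B.sgn := by
  induction A with
  | nil v => simp [Walk.append, Walk.sgn]
  | cons e d p ih => simp [Walk.append, Walk.sgn, ih, mul_assoc]

lemma Walk.exists_edge (e : E) (d : Bool) :
    ∃ W : Γ.Walk (Γ.endpt e d) (Γ.endpt e (!d)), W.sgn = Γ.sign e :=
  ⟨.cons e d (.nil _), by simp [Walk.sgn]⟩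

lemma Walk.exists_rev {u v : V} (A : Γ.Walk u v) : ∃ B : Γ.Walk v u, B.sgn = A.sgn := by
  induction A with
  | nil v => exact ⟨.nil v, rfl⟩
  | cons e d p ih =>
    obtain ⟨B, hB⟩ := ih
    have h : ∃ W : Γ.Walk (Γ.endpt e (!d)) (Γ.endpt e d), W.sgn = Γ.sign e := by
      have := Walk.exists_edge (Γ := Γ) e (!d)
      rwa [Bool.not_not] at this
    obtain ⟨W, hW⟩ := h
    exact ⟨B.append W, by rw [Walk.sgn_append_s2, Walk.sgn_cons, hB, hW, mul_comm]⟩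

lemma exists_walk {u v : V} (h : Γ.comp u = Γ.comp v) : Nonempty (Γ.Walk u v) := by
  have h' := Quot.eqvGen_exact h
  induction h' with
  | rel x y hxy =>
    obtain ⟨e, he | he⟩ := hxy
    · have hx : x = Γ.endpt e true := by simp [endpt, he]
      have hy : y = Γ.endpt e false := by simp [endpt, he]
      subst hx; subst hy
      exact ⟨(Walk.exists_edge e true).choose⟩
    · have hx : x = Γ.endpt e false := by simp [endpt, he]
      have hy : y = Γ.endpt e true := by simp [endpt, he]
      subst hx; subst hy
      exact ⟨(Walk.exists_edge e false).choose⟩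
  | refl x => exact ⟨.nil x⟩
  | symm x y _ ih => exact ⟨((ih (Quot.eqvGen_sound ‹_›)).some.exists_rev).choose⟩
  | trans x y z h1 h2 ih1 ih2 =>
    exact ⟨(ih1 (Quot.eqvGen_sound h1)).some.append (ih2 (Quot.eqvGen_sound h2)).some⟩

lemma Walk.split_mem {u w x : V} (W : Γ.Walk u w) (hx : x ∈ W.srcs) :
    ∃ (A : Γ.Walk u x) (B : Γ.Walk x w), W.sgn = A.sgn * B.sgn ∧
      W.len = A.len + B.len ∧ 0 < B.len := by
  induction W with
  | nil v => simp [Walk.srcs, Walk.verts] at hx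
  | cons e d p ih =>
    rw [Walk.srcs_cons_s2, List.mem_cons] at hx
    by_cases h : x = Γ.endpt e d
    · subst h
      refine ⟨.nil _, .cons e d p, by simp [Walk.sgn], by simp [Walk.len, Walk.edges], ?_⟩
      simp [Walk.len, Walk.edges]
    · obtain ⟨A, B, h1, h2, h3⟩ := ih (hx.resolve_left h)
      refine ⟨.cons e d A, B, ?_, ?_, h3⟩
      · simp only [Walk.sgn_cons, h1, mul_assoc]
      · simp only [Walk.len_cons]; omega

lemma Walk.split_edge_s2 {u w : V} (W : Γ.Walk u w) (e : E) (he : e ∈ W.edges) :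
    ∃ (d : Bool) (A : Γ.Walk u (Γ.endpt e d)) (B : Γ.Walk (Γ.endpt e (!d)) w),
      W.sgn = A.sgn * (Γ.sign e * B.sgn) ∧ W.len = A.len + B.len + 1 := by
  induction W with
  | nil v => simp [Walk.edges] at he
  | cons e' d p ih =>
    rw [Walk.edges, List.mem_cons] at he
    by_cases h : e = e'
    · subst h
      exact ⟨d, .nil _, p, by simp [Walk.sgn], by simp [Walk.len, Walk.edges]⟩
    · obtain ⟨d', A, B, h1, h2⟩ := ih (he.resolve_left h)
      refine ⟨d', .cons e' d A, B, ?_, ?_⟩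
      · simp only [Walk.sgn_cons, h1, mul_assoc]
      · simp only [Walk.len_cons]; omega

lemma Walk.dup_src_s2 {u w : V} (W : Γ.Walk u w) (h : ¬ W.srcs.Nodup) :
    ∃ (x : V) (P : Γ.Walk u w) (Q : Γ.Walk x x), W.sgn = P.sgn * Q.sgn ∧
      P.len < W.len ∧ Q.len < W.len ∧ Γ.comp x = Γ.comp u := by
  induction W with
  | nil v => simp [Walk.srcs, Walk.verts] at h
  | cons e d p ih =>
    rw [Walk.srcs_cons_s2, List.nodup_cons] at h
    by_cases hm : Γ.endpt e d ∈ p.srcs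
    · obtain ⟨A, B, h1, h2, h3⟩ := p.split_mem hm
      refine ⟨_, B, .cons e d A, ?_, ?_, ?_, rfl⟩
      · simp only [Walk.sgn_cons, h1, mul_assoc, mul_comm]
      · rw [Walk.len_cons]; omega
      · rw [Walk.len_cons, Walk.len_cons]; omega
    · obtain ⟨x, P, Q, h1, h2, h3, h4⟩ := ih (fun h' => h ⟨hm, h'⟩)
      refine ⟨x, .cons e d P, Q, ?_, ?_, ?_, h4.trans (comp_endpt e d)⟩
      · simp only [Walk.sgn_cons, h1, mul_assoc]
      · rw [Walk.len_cons, Walk.len_cons]; omega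
      · rw [Walk.len_cons]; omega

lemma Walk.dup_edge_s2 {u w : V} (W : Γ.Walk u w) (h : ¬ W.edges.Nodup) :
    ∃ (x : V) (P : Γ.Walk u w) (Q : Γ.Walk x x), W.sgn = P.sgn * Q.sgn ∧
      P.len < W.len ∧ Q.len < W.len ∧ Γ.comp x = Γ.comp u := by
  induction W with
  | nil v => simp [Walk.edges] at h
  | cons e d p ih =>
    rw [Walk.edges, List.nodup_cons] at h
    by_cases hm : e ∈ p.edges
    · obtain ⟨d', A, B, h1, h2⟩ := p.split_edge_s2 e hm
      by_cases hd : d' = d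
      · subst hd
        refine ⟨_, .cons e d' B, .cons e d' A, ?_, ?_, ?_, rfl⟩
        · simp only [Walk.sgn_cons, h1, mul_assoc, mul_comm, mul_left_comm]
        · rw [Walk.len_cons, Walk.len_cons]; omega
        · rw [Walk.len_cons, Walk.len_cons]; omega
      · have hd' : d = !d' := by cases d <;> cases d' <;> simp_all
        subst hd'
        have hc : Γ.comp (Γ.endpt e d') = Γ.comp (Γ.endpt e (!d')) := (comp_endpt e d').symm
        have key : ∃ A' : Γ.Walk (Γ.endpt e d') (Γ.endpt e d'), A'.sgn = A.sgn ∧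
            A'.len = A.len := by
          clear h1 h2
          cases d' <;> exact ⟨A, rfl, rfl⟩
        obtain ⟨A', hs, hl⟩ := key
        refine ⟨_, B, A', ?_, ?_, ?_, hc⟩
        · rw [Walk.sgn_cons, h1, hs, mul_left_comm, ← mul_assoc (Γ.sign e), Int.units_mul_self,
            one_mul, mul_comm]
        · rw [Walk.len_cons]; omega
        · rw [Walk.len_cons]; omega
    · obtain ⟨x, P, Q, h1, h2, h3, h4⟩ := ih (fun h' => h ⟨hm, h'⟩)
      refine ⟨x, .cons e d P, Q, ?_, ?_, ?_, h4.trans (comp_endpt e d)⟩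
      · simp only [Walk.sgn_cons, h1, mul_assoc]
      · rw [Walk.len_cons, Walk.len_cons]; omega
      · rw [Walk.len_cons]; omega

lemma exists_cycle_of_neg (n : ℕ) : ∀ {v : V} (W : Γ.Walk v v), W.len ≤ n → W.sgn ≠ 1 →
    ∃ (x : V) (C : Γ.Walk x x), Γ.IsCycle C ∧ C.sgn ≠ 1 ∧ Γ.comp x = Γ.comp v := by
  induction n with
  | zero =>
    intro v W hl hs
    exfalso
    apply hs
    cases W with
    | nil => rfl
    | cons e d p => rw [Walk.len_cons] at hl; omega
  | succ n ih =>
    intro v W hl hs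
    by_cases hc : W.srcs.Nodup ∧ W.edges.Nodup
    · refine ⟨v, W, ⟨?_, hc.1, hc.2⟩, hs, rfl⟩
      intro he
      have h0 : W.len = 0 := by simp [Walk.len, he]
      obtain ⟨x, C, hC, -⟩ := ih W (by omega) hs
      apply hs
      generalize hv : v = w at W
      cases W with
      | nil => rfl
      | cons e d p => rw [Walk.len_cons] at h0; omega
    · have : ∃ (x : V) (P : Γ.Walk v v) (Q : Γ.Walk x x), W.sgn = P.sgn * Q.sgn ∧
          P.len < W.len ∧ Q.len < W.len ∧ Γ.comp x = Γ.comp v := by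
        by_cases h1 : W.srcs.Nodup
        · exact W.dup_edge_s2 (fun h2 => hc ⟨h1, h2⟩)
        · exact W.dup_src_s2 h1
      obtain ⟨x, P, Q, h1, h2, h3, h4⟩ := this
      by_cases hP : P.sgn = 1
      · obtain ⟨y, C, a, b, c⟩ := ih Q (by omega) (by rwa [h1, hP, one_mul] at hs)
        exact ⟨y, C, a, b, c.trans h4⟩
      · exact ih P (by omega) hP

lemma sgn_eq_one_of_balanced {v : V} (hb : Γ.IsBalancedComponent (Γ.comp v)) (W : Γ.Walk v v) :
    W.sgn = 1 := by
  by_contra h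
  obtain ⟨x, C, hC, hs, hx⟩ := exists_cycle_of_neg _ W le_rfl h
  exact hs (hb x hx C hC)

/-- chosen root of a component -/
def root (c : Γ.Components) : V := (Quot.exists_rep c).choose

lemma comp_root (c : Γ.Components) : Γ.comp (root c) = c := (Quot.exists_rep c).choose_spec

lemma exists_rootWalk (v : V) : Nonempty (Γ.Walk v (root (Γ.comp v))) :=
  exists_walk (comp_root _).symm

def rootWalk (v : V) : Γ.Walk v (root (Γ.comp v)) := (exists_rootWalk v).some

/-- switching potential -/
def pot (Γ : SGraph V E) (v : V) : ℤˣ := (rootWalk (Γ := Γ) v).sgn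

lemma pot_edge (e : E) (hb : Γ.IsBalancedComponent (Γ.comp (Γ.endpt e true))) :
    Γ.pot (Γ.endpt e true) = Γ.sign e * Γ.pot (Γ.endpt e false) := by
  have hc : Γ.comp (Γ.endpt e false) = Γ.comp (Γ.endpt e true) := comp_endpt e true
  obtain ⟨B, hB⟩ := (rootWalk (Γ := Γ) (Γ.endpt e true)).exists_rev
  have h2 : ∃ C : Γ.Walk (Γ.endpt e false) (root (Γ.comp (Γ.endpt e true))),
      C.sgn = Γ.pot (Γ.endpt e false) := by
    rw [← hc]; exact ⟨rootWalk _, rfl⟩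
  obtain ⟨C, hC⟩ := h2
  have h := sgn_eq_one_of_balanced hb (Walk.cons e true (C.append B))
  rw [Walk.sgn_cons, Walk.sgn_append_s2, hC, hB, ← mul_assoc] at h
  have h' := mul_eq_one_iff_eq_inv.mp h
  rw [Int.units_inv_eq_self] at h'
  exact h'.symm

variable [Fintype V] [Fintype E] {G : Type} [AddCommGroup G]

/-- boundary map -/
def bdry (Γ : SGraph V E) (ω : E → Bool → ℤˣ) (G : Type) [AddCommGroup G] :
    (E → G) →+ (V → G) :=
  AddMonoidHom.mk' (fun f => ∑ e : E, (Pi.single (Γ.endpt e true) ((ω e true : ℤ) • f e) +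
      Pi.single (Γ.endpt e false) ((ω e false : ℤ) • f e))) (by
    intro a b
    rw [← Finset.sum_add_distrib]
    refine Finset.sum_congr rfl fun e _ => ?_
    simp only [Pi.add_apply, smul_add, Pi.single_add]
    abel)

lemma bdry_apply (ω : E → Bool → ℤˣ) (f : E → G) : Γ.bdry ω G f =
    ∑ e : E, (Pi.single (Γ.endpt e true) ((ω e true : ℤ) • f e) +
      Pi.single (Γ.endpt e false) ((ω e false : ℤ) • f e)) := rfl

lemma isFlow_iff (ω : E → Bool → ℤˣ) (f : E → G) : Γ.IsFlow ω f ↔ f ∈ (Γ.bdry ω G).ker := by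
  rw [AddMonoidHom.mem_ker, bdry_apply, funext_iff]
  unfold IsFlow
  refine forall_congr' fun v => ?_
  rw [finsum_eq_sum_of_fintype, Finset.sum_apply]
  simp only [Pi.add_apply, Pi.single_apply, Pi.zero_apply, eq_comm (a := v)]

/-- subgroup by which the total of a component is quotiented -/
def sub (Γ : SGraph V E) (G : Type) [AddCommGroup G] (c : Γ.Components) : AddSubgroup G :=
  if Γ.IsBalancedComponent c then ⊥ else twoG G

/-- weighted sum over a component -/
def tot (Γ : SGraph V E) (G : Type) [AddCommGroup G] (c : Γ.Components) : (V → G) →+ G :=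
  AddMonoidHom.mk' (fun g => ∑ v : V, if Γ.comp v = c then (Γ.pot v : ℤ) • g v else 0) (by
    intro a b
    rw [← Finset.sum_add_distrib]
    refine Finset.sum_congr rfl fun v _ => ?_
    split_ifs <;> simp)

lemma tot_apply (c : Γ.Components) (g : V → G) :
    Γ.tot G c g = ∑ v : V, if Γ.comp v = c then (Γ.pot v : ℤ) • g v else 0 := rfl

lemma tot_single (c : Γ.Components) (v : V) (x : G) :
    Γ.tot G c (Pi.single v x) = if Γ.comp v = c then (Γ.pot v : ℤ) • x else 0 := by
  rw [tot_apply, Finset.sum_eq_single v]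
  · simp
  · intro w _ hw
    simp [Pi.single_eq_of_ne hw]
  · simp

lemma two_mem (x : G) : x + x ∈ twoG G := ⟨x, rfl⟩

lemma tot_bdry_mem (ω : E → Bool → ℤˣ) (hω : Γ.IsCompatible ω) (c : Γ.Components) (f : E → G) :
    Γ.tot G c (Γ.bdry ω G f) ∈ Γ.sub G c := by
  rw [bdry_apply, map_sum]
  refine AddSubgroup.sum_mem _ fun e _ => ?_
  rw [map_add, tot_single, tot_single]
  have hc : Γ.comp (Γ.endpt e false) = Γ.comp (Γ.endpt e true) := comp_endpt e true
  rw [hc]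
  split_ifs with h
  swap
  · simp
  unfold sub
  have hs := hω e
  split_ifs with hb
  · rw [AddSubgroup.mem_bot]
    subst h
    have hp := pot_edge e hb
    rw [hp, hs]
    rcases Int.units_eq_one_or (ω e true) with h1 | h1 <;>
    rcases Int.units_eq_one_or (ω e false) with h2 | h2 <;>
    rcases Int.units_eq_one_or (Γ.pot (Γ.endpt e false)) with h3 | h3 <;>
    simp [h1, h2, h3]
  · have hx := two_mem (f e)
    have hx' := (twoG G).neg_mem hx
    rw [neg_add] at hx'
    rcases Int.units_eq_one_or (ω e true) with h1 | h1 <;>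
    rcases Int.units_eq_one_or (ω e false) with h2 | h2 <;>
    rcases Int.units_eq_one_or (Γ.pot (Γ.endpt e false)) with h3 | h3 <;>
    rcases Int.units_eq_one_or (Γ.pot (Γ.endpt e true)) with h4 | h4 <;>
    simp [h1, h2, h3, h4, hx] <;> simpa using hx'

lemma bdry_single (ω : E → Bool → ℤˣ) (e : E) (x : G) :
    Γ.bdry ω G (Pi.single e x) = Pi.single (Γ.endpt e true) ((ω e true : ℤ) • x) +
      Pi.single (Γ.endpt e false) ((ω e false : ℤ) • x) := by
  rw [bdry_apply, Finset.sum_eq_single e]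
  · simp
  · intro w _ hw
    simp [Pi.single_eq_of_ne hw]
  · simp

lemma edge_mem (ω : E → Bool → ℤˣ) (hω : Γ.IsCompatible ω) (e : E) (d : Bool) (x : G) :
    (Pi.single (Γ.endpt e d) x - Pi.single (Γ.endpt e (!d)) ((Γ.sign e : ℤ) • x) : V → G) ∈
      (Γ.bdry ω G).range := by
  refine ⟨Pi.single e ((ω e d : ℤ) • x), ?_⟩
  have hs := hω e
  rw [bdry_single, hs, sub_eq_add_neg, ← Pi.single_neg]
  cases d <;>
  rcases Int.units_eq_one_or (ω e true) with h1 | h1 <;>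
  rcases Int.units_eq_one_or (ω e false) with h2 | h2 <;>
  simp [h1, h2, add_comm]

lemma walk_mem (ω : E → Bool → ℤˣ) (hω : Γ.IsCompatible ω) {u w : V} (W : Γ.Walk u w) (x : G) :
    (Pi.single u x - Pi.single w ((W.sgn : ℤ) • x) : V → G) ∈ (Γ.bdry ω G).range := by
  induction W generalizing x with
  | nil v => simp [Walk.sgn]
  | cons e d p ih =>
    have h := AddSubgroup.add_mem _ (edge_mem ω hω e d x) (ih ((Γ.sign e : ℤ) • x))
    rw [sub_add_sub_cancel, smul_smul, mul_comm] at h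
    rw [Walk.sgn_cons]
    simpa using h

lemma root_mem (ω : E → Bool → ℤˣ) (hω : Γ.IsCompatible ω) (c : Γ.Components) (x : G)
    (hx : x ∈ Γ.sub G c) : (Pi.single (root c) x : V → G) ∈ (Γ.bdry ω G).range := by
  unfold sub at hx
  split_ifs at hx with hb
  · rw [AddSubgroup.mem_bot] at hx
    simp [hx]
  · obtain ⟨y, rfl⟩ := hx
    unfold IsBalancedComponent at hb
    push Not at hb
    obtain ⟨v, hv, W, -, hs⟩ := hb
    have hs' : W.sgn = -1 := (Int.units_eq_one_or _).resolve_left hs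
    obtain ⟨A⟩ := exists_walk ((comp_root c).trans hv.symm)
    obtain ⟨B, hB⟩ := A.exists_rev
    have h := walk_mem ω hω (A.append (W.append B)) y
    rw [Walk.sgn_append_s2, Walk.sgn_append_s2, hB, hs', mul_left_comm, Int.units_mul_self] at h
    have hd : doubleHom G y = y + y := rfl
    rw [hd, Pi.single_add]
    simpa [Pi.single_neg, sub_neg_eq_add] using h

lemma mem_range_of_tot (ω : E → Bool → ℤˣ) (hω : Γ.IsCompatible ω) (g : V → G)
    (hg : ∀ c, Γ.tot G c g ∈ Γ.sub G c) : g ∈ (Γ.bdry ω G).range := by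
  haveI : Finite Γ.Components := Quot.finite _
  haveI := Fintype.ofFinite Γ.Components
  have h1 : (∑ v, (Pi.single v (g v) - Pi.single (root (Γ.comp v)) ((Γ.pot v : ℤ) • g v)) : V → G)
      ∈ (Γ.bdry ω G).range :=
    AddSubgroup.sum_mem _ fun v _ => walk_mem ω hω (rootWalk v) (g v)
  have h2 : (∑ c, Pi.single (root c) (Γ.tot G c g) : V → G) ∈ (Γ.bdry ω G).range :=
    AddSubgroup.sum_mem _ fun c _ => root_mem ω hω c _ (hg c)
  have h3 : (∑ c, Pi.single (root c) (Γ.tot G c g) : V → G) =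
      ∑ v, Pi.single (root (Γ.comp v)) ((Γ.pot v : ℤ) • g v) := by
    have : ∀ c, (Pi.single (root c) (Γ.tot G c g) : V → G) =
        ∑ v, if Γ.comp v = c then Pi.single (root c) ((Γ.pot v : ℤ) • g v) else 0 := by
      intro c
      rw [tot_apply]
      have := map_sum (AddMonoidHom.single (fun _ : V => G) (root c))
        (fun v => if Γ.comp v = c then (Γ.pot v : ℤ) • g v else 0) Finset.univ
      simp only [AddMonoidHom.single_apply] at this
      rw [this]
      refine Finset.sum_congr rfl fun v _ => ?_
      split_ifs <;> simp
    simp only [this]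
    rw [Finset.sum_comm]
    refine Finset.sum_congr rfl fun v _ => ?_
    simp
  have h4 := AddSubgroup.add_mem _ h1 h2
  rw [h3, Finset.sum_sub_distrib, sub_add_cancel, Finset.univ_sum_single] at h4
  exact h4

/-- projection to the cokernel -/
def proj (Γ : SGraph V E) (G : Type) [AddCommGroup G] :
    (V → G) →+ (∀ c : Γ.Components, G ⧸ Γ.sub G c) :=
  AddMonoidHom.pi fun c => (QuotientAddGroup.mk' (Γ.sub G c)).comp (Γ.tot G c)

lemma proj_ker (ω : E → Bool → ℤˣ) (hω : Γ.IsCompatible ω) :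
    (Γ.proj G).ker = (Γ.bdry ω G).range := by
  ext g
  have : g ∈ (Γ.proj G).ker ↔ ∀ c, Γ.tot G c g ∈ Γ.sub G c := by
    rw [AddMonoidHom.mem_ker, funext_iff]
    refine forall_congr' fun c => ?_
    exact QuotientAddGroup.eq_zero_iff _
  rw [this]
  constructor
  · exact mem_range_of_tot ω hω g
  · rintro ⟨f, rfl⟩ c
    exact tot_bdry_mem ω hω c f

lemma proj_surj : Function.Surjective (Γ.proj G) := by
  intro q
  choose x hx using fun c => QuotientAddGroup.mk'_surjective (Γ.sub G c) (q c)
  refine ⟨fun v => if v = root (Γ.comp v) then (Γ.pot v : ℤ) • x (Γ.comp v) else 0, ?_⟩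
  funext c
  rw [← hx c]
  change QuotientAddGroup.mk' (Γ.sub G c) (Γ.tot G c _) = _
  congr 1
  rw [tot_apply, Finset.sum_eq_single (root c)]
  · simp only [comp_root, if_true, smul_smul]
    rw [← Units.val_mul, Int.units_mul_self]
    simp
  · intro v _ hv
    split_ifs with h1 h2
    · rw [h1] at h2; exact absurd h2 hv
    · simp
    · rfl
  · simp

lemma card_ker_mul_range {A B : Type} [AddCommGroup A] [AddCommGroup B] (φ : A →+ B) :
    Nat.card φ.ker * Nat.card φ.range = Nat.card A := by
  rw [AddSubgroup.card_eq_card_quotient_mul_card_addSubgroup φ.ker,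
    Nat.card_congr (QuotientAddGroup.quotientKerEquivRange φ).toEquiv, mul_comm]

lemma card_prod [Finite G] : (Nat.card (∀ c : Γ.Components, G ⧸ Γ.sub G c) : ℚ) =
    (Nat.card G : ℚ) ^ Γ.kb * ((Nat.card G : ℚ) / (Nat.card (twoG G) : ℚ)) ^ Γ.ku := by
  haveI : Finite Γ.Components := Quot.finite _
  haveI := Fintype.ofFinite Γ.Components
  have hq : ∀ c, (Nat.card (G ⧸ Γ.sub G c) : ℚ) = if Γ.IsBalancedComponent c then
      (Nat.card G : ℚ) else ((Nat.card G : ℚ) / (Nat.card (twoG G) : ℚ)) := by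
    intro c
    have h := AddSubgroup.card_eq_card_quotient_mul_card_addSubgroup (Γ.sub G c)
    unfold sub at h ⊢
    split_ifs at h ⊢ with hb
    · simp at h ⊢
      exact h.symm
    · rw [eq_div_iff (by exact_mod_cast Nat.card_pos.ne'), h]
      push_cast
      rfl
  rw [Nat.card_pi]
  push_cast
  simp only [hq]
  rw [Finset.prod_ite, Finset.prod_const, Finset.prod_const]
  simp only [kb, ku, Nat.card_eq_fintype_card, Fintype.card_subtype]

lemma card_flows_mul [Finite G] (ω : E → Bool → ℤˣ) (hω : Γ.IsCompatible ω) :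
    (Nat.card {f : E → G // Γ.IsFlow ω f} : ℚ) * (Nat.card G : ℚ) ^ Nat.card V =
      (Nat.card G : ℚ) ^ (Nat.card E + Γ.kb) *
        ((Nat.card G : ℚ) / (Nat.card (twoG G) : ℚ)) ^ Γ.ku := by
  have e1 : Nat.card {f : E → G // Γ.IsFlow ω f} = Nat.card (Γ.bdry ω G).ker :=
    Nat.card_congr (Equiv.subtypeEquivRight fun f => isFlow_iff ω f)
  have h1 := card_ker_mul_range (Γ.bdry ω G)
  have h2 := card_ker_mul_range (Γ.proj G)
  rw [proj_ker ω hω, AddMonoidHom.range_eq_top.mpr (proj_surj (Γ := Γ) (G := G)), AddSubgroup.card_top] at h2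
  have h3 : Nat.card (E → G) = Nat.card G ^ Nat.card E := Nat.card_fun
  have h4 : Nat.card (V → G) = Nat.card G ^ Nat.card V := Nat.card_fun
  rw [h3] at h1
  rw [h4] at h2
  have h5 := card_prod (Γ := Γ) (G := G)
  rw [e1, pow_add, mul_assoc, ← h5, ← Nat.cast_pow, ← Nat.cast_pow, ← h1, ← h2]
  push_cast
  ring

lemma card_V_le (ω : E → Bool → ℤˣ) (hω : Γ.IsCompatible ω) :
    Nat.card V ≤ Nat.card E + Γ.kb := by
  have h := card_flows_mul (G := ZMod 3) ω hω
  have h2 : twoG (ZMod 3) = ⊤ := by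
    rw [eq_top_iff]
    intro x _
    refine ⟨x + x, ?_⟩
    change (x + x) + (x + x) = x
    have h3 : (3 : ZMod 3) = 0 := rfl
    linear_combination x * h3
  rw [h2, AddSubgroup.card_top, Nat.card_zmod, div_self (by norm_num), one_pow, mul_one] at h
  have h' : Nat.card {f : E → ZMod 3 // Γ.IsFlow ω f} * 3 ^ Nat.card V =
    3 ^ (Nat.card E + Γ.kb) := by exact_mod_cast h
  exact (Nat.pow_dvd_pow_iff_le_right (by norm_num : 1 < 3)).mp (Dvd.intro_left _ h')

end Helpers

end SGraph

end Aux

section Statement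

open SGraph

/-- Theorem 5.1: the number of `G`-flows of a signed graph is
`|G|^{|E|−|V|+k_b(Σ)} · (|G|/|2G|)^{k_u(Σ)}`. -/
theorem card_flows (V E : Type) [Finite V] [Finite E] (Γ : SGraph V E)
    (ω : E → Bool → ℤˣ) (hω : Γ.IsCompatible ω)
    (G : Type) [AddCommGroup G] [Finite G] :
    (Nat.card {f : E → G // Γ.IsFlow ω f} : ℚ) =
      (Nat.card G : ℚ) ^ ((Nat.card E + Γ.kb) - Nat.card V) *
        ((Nat.card G : ℚ) / (Nat.card (twoG G) : ℚ)) ^ Γ.ku := by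
  haveI := Fintype.ofFinite V
  haveI := Fintype.ofFinite E
  have h := card_flows_mul (Γ := Γ) (G := G) ω hω
  have hle := card_V_le (Γ := Γ) ω hω
  have hG : (Nat.card G : ℚ) ^ Nat.card V ≠ 0 :=
    pow_ne_zero _ (by exact_mod_cast Nat.card_pos.ne')
  apply mul_right_cancel₀ hG
  rw [h, mul_right_comm, ← pow_add, Nat.sub_add_cancel hle]

end Statement
end
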